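/- Let d≥3 and let V and Y be real Γ-periodic potentials on ℤ^d that are Fermi isospectral. Suppose Y=Y_1⊕Y_2⊕⋯⊕Y_d is completely separable. Then V=V_1⊕V_2⊕⋯⊕V_d is completely separable, and for each j=1,…,d there exists a constant c_j∈ℝ such that V_j+c_j and Y_j are Floquet isospectral as q_j-periodic potentials on ℤ. -/

import Mathlib

noncomputable section

/-- The discrete Laplacian on `ℤ^d`: `(Δu)(n) = Σ_{‖n'-n‖₁ = 1} u(n')`. -/
def discLap {d : ℕ} (u : (Fin d → ℤ) → ℂ) (n : Fin d → ℤ) : ℂ :=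
  ∑ j : Fin d, (u (Function.update n j (n j + 1)) + u (Function.update n j (n j - 1)))

/-- Reduction of an integer modulo `q`, as an element of `Fin q`. -/
def fem (q : ℕ+) (a : ℤ) : Fin (q : ℕ) :=
  ⟨(a % ((q : ℕ) : ℤ)).toNat, by
    have hq : (0:ℤ) < ((q : ℕ) : ℤ) := by exact_mod_cast q.pos
    have h1 : 0 ≤ a % ((q : ℕ) : ℤ) := Int.emod_nonneg a (ne_of_gt hq)
    have h2 : a % ((q : ℕ) : ℤ) < ((q : ℕ) : ℤ) := Int.emod_lt_of_pos a hq
    omega⟩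

/-- Extension of a function on the fundamental domain `W` to `ℤ^d` using the
Floquet boundary conditions `u(n + qⱼ eⱼ) = zⱼ u(n)`. -/
def extendBC {d : ℕ} (q : Fin d → ℕ+) (z : Fin d → ℂ)
    (u : (∀ j, Fin ((q j : ℕ))) → ℂ) : (Fin d → ℤ) → ℂ :=
  fun n => (∏ j, z j ^ (n j / ((q j : ℕ) : ℤ))) * u (fun j => fem (q j) (n j))

/-- The matrix `D_V(z)` of the Floquet reduction of `-Δ + V` to the fundamental domain. -/
def DVmat {d : ℕ} (q : Fin d → ℕ+) (V : (Fin d → ℤ) → ℂ) (z : Fin d → ℂ) :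
    Matrix (∀ j, Fin ((q j : ℕ))) (∀ j, Fin ((q j : ℕ))) ℂ :=
  fun n n' =>
    -(discLap (extendBC q z (Pi.single n' 1)) (fun j => ((n j : ℕ) : ℤ)))
      + V (fun j => ((n j : ℕ) : ℤ)) * (if n = n' then 1 else 0)

/-- `𝒫_V(z, λ) = det(D_V(z) - λ I)`. -/
def scriptP {d : ℕ} (q : Fin d → ℕ+) (V : (Fin d → ℤ) → ℂ) (z : Fin d → ℂ)
    (lam : ℂ) : ℂ :=
  Matrix.det (DVmat q V z - lam • (1 : Matrix (∀ j, Fin ((q j : ℕ))) (∀ j, Fin ((q j : ℕ))) ℂ))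

/-- `Γ`-periodicity for a complex-valued function on `ℤ^d`. -/
def IsPeriodic {d : ℕ} (q : Fin d → ℕ+) (V : (Fin d → ℤ) → ℂ) : Prop :=
  ∀ (n : Fin d → ℤ) (j : Fin d), V (Function.update n j (n j + ((q j : ℕ) : ℤ))) = V n

/-- `Γ`-periodicity for a real-valued function on `ℤ^d`. -/
def IsPeriodicR {d : ℕ} (q : Fin d → ℕ+) (V : (Fin d → ℤ) → ℝ) : Prop :=
  ∀ (n : Fin d → ℤ) (j : Fin d), V (Function.update n j (n j + ((q j : ℕ) : ℤ))) = V n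

/-- `ρ_m = e^{2πi m / q}`. -/
def rho (q : ℕ+) (m : ℕ) : ℂ :=
  Complex.exp (2 * (Real.pi : ℂ) * Complex.I * (m : ℂ) / ((q : ℕ) : ℂ))

/-- The discrete Fourier transform `V̂(l)` of a periodic potential. -/
def dft {d : ℕ} (q : Fin d → ℕ+) (V : (Fin d → ℤ) → ℂ) (l : Fin d → ℤ) : ℂ :=
  (1 / ((∏ j, (q j : ℕ) : ℕ) : ℂ)) * ∑ n : (∀ j, Fin ((q j : ℕ))),
    V (fun j => ((n j : ℕ) : ℤ)) *
      Complex.exp (-(2 * (Real.pi : ℂ) * Complex.I) * ∑ j, (l j : ℂ) * ((n j : ℕ) : ℂ) / ((q j : ℕ) : ℂ))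

/-- The diagonal matrix `A(z)` with entries `-Σⱼ (ρʲ_{nⱼ} zⱼ + 1/(ρʲ_{nⱼ} zⱼ))`. -/
def Amat {d : ℕ} (q : Fin d → ℕ+) (z : Fin d → ℂ) :
    Matrix (∀ j, Fin ((q j : ℕ))) (∀ j, Fin ((q j : ℕ))) ℂ :=
  Matrix.diagonal fun n => -(∑ j, (rho (q j) (n j) * z j + (rho (q j) (n j) * z j)⁻¹))

/-- The matrix `B_V` with entries `V̂(n - n')`. -/
def Bmat {d : ℕ} (q : Fin d → ℕ+) (V : (Fin d → ℤ) → ℂ) :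
    Matrix (∀ j, Fin ((q j : ℕ))) (∀ j, Fin ((q j : ℕ))) ℂ :=
  fun n n' => dft q V (fun j => ((n j : ℕ) : ℤ) - ((n' j : ℕ) : ℤ))

/-- The average `[V]` of a periodic potential. -/
def avgPot {d : ℕ} (q : Fin d → ℕ+) (V : (Fin d → ℤ) → ℂ) : ℂ :=
  (1 / ((∏ j, (q j : ℕ) : ℕ) : ℂ)) * ∑ n : (∀ j, Fin ((q j : ℕ))), V (fun j => ((n j : ℕ) : ℤ))

/-- The Fermi variety `F_λ(V)`. -/
def FermiVariety {d : ℕ} (q : Fin d → ℕ+) (V : (Fin d → ℤ) → ℂ) (lam : ℂ) :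
    Set (Fin d → ℂ) :=
  {k | ∃ u : (Fin d → ℤ) → ℂ, u ≠ 0 ∧
    (∀ n, -(discLap u n) + V n * u n = lam * u n) ∧
    (∀ (n : Fin d → ℤ) (j : Fin d),
      u (Function.update n j (n j + ((q j : ℕ) : ℤ)))
        = Complex.exp (2 * (Real.pi : ℂ) * Complex.I * k j) * u n)}

/-- Floquet isospectrality of two real periodic potentials. -/
def FloquetIso {d : ℕ} (q : Fin d → ℕ+) (V Y : (Fin d → ℤ) → ℝ) : Prop :=
  ∀ k : Fin d → ℝ,
    spectrum ℂ (DVmat q (fun n => ((V n : ℝ) : ℂ))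
        (fun j => Complex.exp (2 * (Real.pi : ℂ) * Complex.I * (k j : ℂ))))
      = spectrum ℂ (DVmat q (fun n => ((Y n : ℝ) : ℂ))
        (fun j => Complex.exp (2 * (Real.pi : ℂ) * Complex.I * (k j : ℂ))))

/-- A function on `(ℂ^*)^d` given by a Laurent polynomial. -/
def IsLaurent {d : ℕ} (f : (Fin d → ℂ) → ℂ) : Prop :=
  ∃ c : (Fin d → ℤ) →₀ ℂ, ∀ z : Fin d → ℂ, (∀ j, z j ≠ 0) →
    f z = c.sum fun a C => C * ∏ j, z j ^ a j

/-- A Laurent monomial `C z₁^{a₁} ⋯ z_d^{a_d}` with `C ≠ 0`. -/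
def IsMonomial {d : ℕ} (f : (Fin d → ℂ) → ℂ) : Prop :=
  ∃ (C : ℂ) (a : Fin d → ℤ), C ≠ 0 ∧ ∀ z : Fin d → ℂ, (∀ j, z j ≠ 0) →
    f z = C * ∏ j, z j ^ a j

/-- Irreducibility of a Laurent polynomial: no factorization into two non-monomial
Laurent polynomials. -/
def LaurentIrreducible {d : ℕ} (h : (Fin d → ℂ) → ℂ) : Prop :=
  ¬ ∃ f g : (Fin d → ℂ) → ℂ, IsLaurent f ∧ IsLaurent g ∧
      ¬ IsMonomial f ∧ ¬ IsMonomial g ∧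
      ∀ z : Fin d → ℂ, (∀ j, z j ≠ 0) → h z = f z * g z

section FermiIsospectral

open Filter Topology Finset

section Fourier

variable {G : Type*} [AddCommGroup G] [Fintype G]

/-- The normalised Fourier coefficient of a function on a finite abelian group. -/
def fcoef (f : G → ℂ) (ψ : AddChar G ℂ) : ℂ :=
  (Fintype.card G : ℂ)⁻¹ * ∑ x, ψ (-x) * f x

lemma fcoef_inversion (f : G → ℂ) (x : G) : ∑ ψ : AddChar G ℂ, fcoef f ψ * ψ x = f x := by
  classical
  have hG : (Fintype.card G : ℂ) ≠ 0 := by exact_mod_cast Fintype.card_ne_zero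
  simp only [fcoef, mul_assoc, ← Finset.mul_sum, Finset.sum_mul]
  rw [Finset.sum_comm]
  have : ∀ y : G, ∑ ψ : AddChar G ℂ, ψ (-y) * (f y * ψ x)
      = f y * if x - y = 0 then (Fintype.card G : ℂ) else 0 := fun y => by
    rw [← AddChar.sum_apply_eq_ite, Finset.mul_sum]
    refine Finset.sum_congr rfl fun ψ _ => ?_
    rw [sub_eq_add_neg, AddChar.map_add_eq_mul]; ring
  simp only [this, sub_eq_zero, Finset.sum_ite_eq, mul_ite, mul_zero, Finset.mem_univ, if_true]
  field_simp

lemma fcoef_sum_char (a : AddChar G ℂ → ℂ) (ψ : AddChar G ℂ) :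
    fcoef (fun x => ∑ φ, a φ * φ x) ψ = a ψ := by
  classical
  have hG : (Fintype.card G : ℂ) ≠ 0 := by exact_mod_cast Fintype.card_ne_zero
  simp only [fcoef, Finset.mul_sum]
  rw [Finset.sum_comm]
  have : ∀ φ : AddChar G ℂ, ∑ x, (Fintype.card G : ℂ)⁻¹ * (ψ (-x) * (a φ * φ x))
      = if φ = ψ then a φ else 0 := fun φ => by
    have h := AddChar.sum_eq_ite (φ / ψ)
    have h2 : ∑ x, (Fintype.card G : ℂ)⁻¹ * (ψ (-x) * (a φ * φ x))
        = (Fintype.card G : ℂ)⁻¹ * a φ * ∑ x, (φ / ψ) x := by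
      rw [Finset.mul_sum]
      refine Finset.sum_congr rfl fun x _ => ?_
      rw [AddChar.div_apply]; ring
    rw [h2, h]
    by_cases hφ : φ = ψ
    · have h1 : φ / ψ = 0 := by rw [hφ, div_self']; rfl
      rw [if_pos h1, if_pos hφ]; field_simp
    · have : φ / ψ ≠ 0 := by
        intro h0
        exact hφ (div_eq_one.mp h0)
      simp [hφ, this]
  simp [this]

lemma fcoef_shift (v : G → ℂ) (a : G) (ψ : AddChar G ℂ) :
    fcoef (fun x => v (x + a)) ψ = ψ a * fcoef v ψ := by
  unfold fcoef
  rw [mul_left_comm]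
  congr 1
  rw [Finset.mul_sum, ← Equiv.sum_comp (Equiv.addRight (-a))]
  refine Finset.sum_congr rfl fun x _ => ?_
  simp only [Equiv.coe_addRight, neg_add_cancel_right, neg_add, neg_neg, AddChar.map_add_eq_mul]
  ring

lemma fcoef_mul (V v : G → ℂ) (ψ : AddChar G ℂ) :
    fcoef (fun x => V x * v x) ψ = ∑ φ, fcoef V (ψ / φ) * fcoef v φ := by
  have h : (fun x => V x * v x)
      = fun x => ∑ χ : AddChar G ℂ, (∑ φ, fcoef V (χ / φ) * fcoef v φ) * χ x := by
    funext x
    rw [← fcoef_inversion v x, Finset.mul_sum]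
    simp only [Finset.sum_mul]
    rw [Finset.sum_comm]
    refine Finset.sum_congr rfl fun φ _ => ?_
    rw [← fcoef_inversion V x, Finset.sum_mul, ← (Equiv.divRight φ).sum_comp]
    refine Finset.sum_congr rfl fun χ _ => ?_
    have : χ x = (χ / φ) x * φ x := by
      rw [← AddChar.mul_apply, div_mul_cancel]
    rw [this]; simp only [Equiv.divRight_apply]; ring
  rw [h, fcoef_sum_char]

lemma fcoef_add (f g : G → ℂ) (ψ : AddChar G ℂ) :
    fcoef (fun x => f x + g x) ψ = fcoef f ψ + fcoef g ψ := by
  simp only [fcoef, mul_add, Finset.sum_add_distrib]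

lemma fcoef_const_mul (c : ℂ) (f : G → ℂ) (ψ : AddChar G ℂ) :
    fcoef (fun x => c * f x) ψ = c * fcoef f ψ := by
  simp only [fcoef, Finset.mul_sum]
  exact Finset.sum_congr rfl fun x _ => by ring

lemma fcoef_sum {ι : Type*} (s : Finset ι) (f : ι → G → ℂ) (ψ : AddChar G ℂ) :
    fcoef (fun x => ∑ j ∈ s, f j x) ψ = ∑ j ∈ s, fcoef (f j) ψ := by
  simp only [fcoef, Finset.mul_sum]
  rw [Finset.sum_comm]

lemma fcoef_ne_zero {v : G → ℂ} (hv : v ≠ 0) : fcoef v ≠ 0 := by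
  intro h
  apply hv
  funext x
  rw [← fcoef_inversion v x, h]; simp

/-- The Floquet-transformed eigenvalue equation on the finite group `G` with steps `e`. -/
def TorusEq {ι : Type*} [Fintype ι] (e : ι → G) (w : ι → ℂ) (V : G → ℂ) (lam : ℂ)
    (v : G → ℂ) : Prop :=
  ∀ x, -(∑ j, (w j * v (x + e j) + (w j)⁻¹ * v (x - e j))) + V x * v x = lam * v x

/-- The Fourier symbol of the Floquet-transformed Laplacian. -/
def symb {ι : Type*} [Fintype ι] (e : ι → G) (w : ι → ℂ) (ψ : AddChar G ℂ) : ℂ :=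
  -(∑ j, (ψ (e j) * w j + (ψ (e j) * w j)⁻¹))

lemma TorusEq.fourier {ι : Type*} [Fintype ι] {e : ι → G} {w : ι → ℂ} {V : G → ℂ} {lam : ℂ}
    {v : G → ℂ} (h : TorusEq e w V lam v) (ψ : AddChar G ℂ) :
    (symb e w ψ - lam) * fcoef v ψ + ∑ φ, fcoef V (ψ / φ) * fcoef v φ = 0 := by
  have h1 := congrArg (fun f => fcoef f ψ) (funext h)
  simp only [sub_eq_add_neg] at h1
  have h2 : (fun x => -(∑ j, (w j * v (x + e j) + (w j)⁻¹ * v (x + -e j))) + V x * v x)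
      = fun x => (-1 : ℂ) * (∑ j, (w j * v (x + e j) + (w j)⁻¹ * v (x + -e j))) + V x * v x := by
    funext x; ring
  rw [h2, fcoef_add, fcoef_const_mul, fcoef_sum, fcoef_mul, fcoef_const_mul] at h1
  simp only [fcoef_add, fcoef_const_mul, fcoef_shift] at h1
  rw [sub_mul, ← h1, symb]
  have : ∀ j, (ψ (e j) * w j + (ψ (e j) * w j)⁻¹) * fcoef v ψ
      = w j * (ψ (e j) * fcoef v ψ) + (w j)⁻¹ * (ψ (-e j) * fcoef v ψ) := fun j => by
    rw [AddChar.map_neg_eq_inv, mul_inv]; ring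
  rw [neg_mul, Finset.sum_mul, Finset.sum_congr rfl fun j _ => this j]
  ring

end Fourier

/-- A kernel vector of a diagonal matrix plus a fixed matrix has a near-resonant diagonal entry. -/
lemma exists_diag_le {I : Type*} [Fintype I] (B : I → I → ℂ) :
    ∃ C : ℝ, ∀ α c : I → ℂ, c ≠ 0 → (∀ i, α i * c i + ∑ k, B i k * c k = 0) →
      ∃ i, ‖α i‖ ≤ C := by
  refine ⟨∑ i, ∑ k, ‖B i k‖, fun α c hc h => ?_⟩
  obtain ⟨i1, hi1⟩ := Function.ne_iff.mp hc
  obtain ⟨i, -, hi⟩ := Finset.exists_max_image Finset.univ (fun i => ‖c i‖) ⟨i1, Finset.mem_univ _⟩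
  have hpos : 0 < ‖c i‖ := (norm_pos_iff.mpr hi1).trans_le (hi i1 (Finset.mem_univ _))
  refine ⟨i, le_of_mul_le_mul_right ?_ hpos⟩
  calc ‖α i‖ * ‖c i‖ = ‖∑ k, B i k * c k‖ := by
        rw [← norm_mul, eq_neg_of_add_eq_zero_left (h i), norm_neg]
    _ ≤ ∑ k, ‖B i k‖ * ‖c i‖ := by
        refine (norm_sum_le _ _).trans (Finset.sum_le_sum fun k _ => ?_)
        rw [norm_mul]
        exact mul_le_mul_of_nonneg_left (hi k (Finset.mem_univ _)) (norm_nonneg _)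
    _ = (∑ k, ‖B i k‖) * ‖c i‖ := by rw [Finset.sum_mul]
    _ ≤ _ := by
        refine mul_le_mul_of_nonneg_right ?_ (norm_nonneg _)
        exact Finset.single_le_sum (f := fun i => ∑ k, ‖B i k‖)
          (fun i _ => Finset.sum_nonneg fun _ _ => norm_nonneg _) (Finset.mem_univ i)

/-- Second-order perturbation theory for the resonant diagonal entry. -/
lemma tendsto_resonant {T I : Type*} [Fintype I] [DecidableEq I] {l : Filter T} (i0 : I)
    (B : I → I → ℂ) (α c : T → I → ℂ) (t : T → ℂ) (m : I → ℂ) (hc : ∀ n, c n ≠ 0)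
    (heq : ∀ n i, α n i * c n i + ∑ k, B i k * c n k = 0)
    (ht : Tendsto (fun n => ‖t n‖) l atTop) (hm : ∀ i, i ≠ i0 → m i ≠ 0)
    (hα : ∀ i, i ≠ i0 → Tendsto (fun n => α n i / t n) l (𝓝 (m i))) :
    Tendsto (fun n => t n * (α n i0 + B i0 i0)) l
      (𝓝 (∑ i ∈ univ.erase i0, B i0 i * B i i0 / m i)) := by
  have ht0 : ∀ᶠ n in l, t n ≠ 0 := by
    filter_upwards [ht.eventually_gt_atTop 0] with n hn
    exact norm_pos_iff.mp hn
  have hti : Tendsto (fun n => (t n)⁻¹) l (𝓝 0) := by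
    rw [tendsto_zero_iff_norm_tendsto_zero]
    simp only [norm_inv]
    exact tendsto_inv_atTop_zero.comp ht
  have hαi : ∀ i, i ≠ i0 → Tendsto (fun n => t n * (α n i)⁻¹) l (𝓝 (m i)⁻¹) := fun i hi => by
    refine ((hα i hi).inv₀ (hm i hi)).congr fun n => ?_
    rw [inv_div, div_eq_mul_inv]
  have hα0 : ∀ i, i ≠ i0 → Tendsto (fun n => (α n i)⁻¹) l (𝓝 0) := fun i hi => by
    have := hti.mul (hαi i hi)
    rw [zero_mul] at this
    refine this.congr' ?_
    filter_upwards [ht0] with n hn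
    field_simp
  have hαne : ∀ i, i ≠ i0 → ∀ᶠ n in l, α n i ≠ 0 := fun i hi => by
    filter_upwards [(hα i hi).eventually_ne (hm i hi)] with n hn h0
    exact hn (by simp [h0])
  set b : ℝ := ∑ i, ∑ k, ‖B i k‖ with hb
  have hb0 : 0 ≤ b := Finset.sum_nonneg fun _ _ => Finset.sum_nonneg fun _ _ => norm_nonneg _
  have hbi : ∀ i, ∑ k, ‖B i k‖ ≤ b := fun i =>
    Finset.single_le_sum (f := fun i => ∑ k, ‖B i k‖)
          (fun i _ => Finset.sum_nonneg fun _ _ => norm_nonneg _) (Finset.mem_univ i)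
  -- the resonant component dominates
  have hdom : ∀ᶠ n in l, c n i0 ≠ 0 ∧ ∀ i, ‖c n i‖ ≤ ‖c n i0‖ := by
    have hsmall : ∀ᶠ n in l, ∀ i, i ≠ i0 → ‖(α n i)⁻¹‖ * b < 1 ∧ α n i ≠ 0 := by
      rw [eventually_all]
      intro i
      by_cases hi : i = i0
      · simp [hi]
      · have : Tendsto (fun n => ‖(α n i)⁻¹‖ * b) l (𝓝 0) := by
          simpa using ((hα0 i hi).norm.mul_const b)
        filter_upwards [this.eventually_lt_const one_pos, hαne i hi] with n h1 h2 _
        exact ⟨h1, h2⟩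
    filter_upwards [hsmall] with n hn
    obtain ⟨i1, hi1⟩ := Function.ne_iff.mp (hc n)
    obtain ⟨i, -, hi⟩ := Finset.exists_max_image Finset.univ (fun i => ‖c n i‖)
      ⟨i1, Finset.mem_univ _⟩
    have hpos : 0 < ‖c n i‖ := (norm_pos_iff.mpr hi1).trans_le (hi i1 (Finset.mem_univ _))
    have hii : i = i0 := by
      by_contra hne
      obtain ⟨h1, h2⟩ := hn i hne
      have h3 : c n i = -((α n i)⁻¹ * ∑ k, B i k * c n k) := by
        have := heq n i
        rw [eq_neg_of_add_eq_zero_right this]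
        field_simp
      have h4 : ‖∑ k, B i k * c n k‖ ≤ b * ‖c n i‖ := by
        refine (norm_sum_le _ _).trans ?_
        refine (Finset.sum_le_sum (g := fun k => ‖B i k‖ * ‖c n i‖) fun k _ => ?_).trans ?_
        · rw [norm_mul]
          exact mul_le_mul_of_nonneg_left (hi k (Finset.mem_univ _)) (norm_nonneg _)
        · rw [← Finset.sum_mul]
          exact mul_le_mul_of_nonneg_right (hbi i) (norm_nonneg _)
      have h5 : ‖c n i‖ ≤ ‖(α n i)⁻¹‖ * b * ‖c n i‖ := by
        conv_lhs => rw [h3, norm_neg, norm_mul]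
        rw [mul_assoc]
        exact mul_le_mul_of_nonneg_left h4 (norm_nonneg _)
      nlinarith
    subst hii
    exact ⟨norm_pos_iff.mp hpos, fun k => hi k (Finset.mem_univ _)⟩
  set r : T → I → ℂ := fun n i => c n i / c n i0 with hr
  have hrle : ∀ᶠ n in l, ∀ i, ‖r n i‖ ≤ 1 := by
    filter_upwards [hdom] with n hn i
    rw [hr]; simp only [norm_div]
    exact (div_le_one (norm_pos_iff.mpr hn.1)).mpr (hn.2 i)
  have hreq : ∀ᶠ n in l, ∀ i, α n i * r n i + ∑ k, B i k * r n k = 0 := by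
    filter_upwards [hdom] with n hn i
    have h1 : α n i * r n i + ∑ k, B i k * r n k
        = (α n i * c n i + ∑ k, B i k * c n k) / c n i0 := by
      rw [add_div, Finset.sum_div]
      simp only [hr, mul_div_assoc]
    rw [h1, heq, zero_div]
  have hreq' : ∀ i, i ≠ i0 → ∀ᶠ n in l, r n i = -((α n i)⁻¹ * ∑ k, B i k * r n k) := fun i hi => by
    filter_upwards [hreq, hαne i hi] with n hn hne
    rw [eq_neg_of_add_eq_zero_right (hn i)]
    field_simp
  have hr0 : ∀ i, i ≠ i0 → Tendsto (fun n => r n i) l (𝓝 0) := fun i hi => by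
    rw [tendsto_zero_iff_norm_tendsto_zero]
    have h1 : Tendsto (fun n => ‖(α n i)⁻¹‖ * b) l (𝓝 0) := by
      simpa using ((hα0 i hi).norm.mul_const b)
    refine squeeze_zero' (Eventually.of_forall fun _ => norm_nonneg _) ?_ h1
    filter_upwards [hreq' i hi, hrle] with n h2 h3
    rw [h2, norm_neg, norm_mul]
    refine mul_le_mul_of_nonneg_left ?_ (norm_nonneg _)
    refine (norm_sum_le _ _).trans ((Finset.sum_le_sum fun k _ => ?_).trans (hbi i))
    rw [norm_mul]
    exact mul_le_of_le_one_right (norm_nonneg _) (h3 k)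
  have hr1 : ∀ᶠ n in l, r n i0 = 1 := by
    filter_upwards [hdom] with n hn
    exact div_self hn.1
  have hS : ∀ i, Tendsto (fun n => ∑ k, B i k * r n k) l (𝓝 (B i i0)) := fun i => by
    have h1 : ∀ k, Tendsto (fun n => B i k * r n k) l (𝓝 (if k = i0 then B i k else 0)) := fun k => by
      by_cases hk : k = i0
      · subst hk
        refine Tendsto.congr' ?_ tendsto_const_nhds
        filter_upwards [hr1] with n hn
        simp [hn]
      · simpa [hk] using (hr0 k hk).const_mul (B i k)
    simpa using tendsto_finsetSum univ fun k _ => h1 k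
  have htr : ∀ i, i ≠ i0 → Tendsto (fun n => t n * r n i) l (𝓝 (-((m i)⁻¹ * B i i0))) := fun i hi => by
    refine ((hαi i hi).mul (hS i)).neg.congr' ?_
    filter_upwards [hreq' i hi] with n hn
    rw [hn]; ring
  have hfin : Tendsto (fun n => ∑ i ∈ univ.erase i0, -(B i0 i * (t n * r n i))) l
      (𝓝 (∑ i ∈ univ.erase i0, -(B i0 i * (-((m i)⁻¹ * B i i0))))) :=
    tendsto_finsetSum _ fun i hi => ((htr i (Finset.ne_of_mem_erase hi)).const_mul _).neg
  have hlim : ∑ i ∈ univ.erase i0, -(B i0 i * (-((m i)⁻¹ * B i i0)))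
      = ∑ i ∈ univ.erase i0, B i0 i * B i i0 / m i :=
    Finset.sum_congr rfl fun i _ => by rw [div_eq_mul_inv]; ring
  rw [hlim] at hfin
  refine hfin.congr' ?_
  filter_upwards [hreq, hr1] with n hn h1
  have h2 := hn i0
  rw [h1, mul_one, ← Finset.add_sum_erase univ _ (Finset.mem_univ i0), h1, mul_one,
    ← add_assoc] at h2
  rw [eq_neg_of_add_eq_zero_left h2, mul_neg, Finset.mul_sum, ← Finset.sum_neg_distrib]
  exact Finset.sum_congr rfl fun i _ => by ring

section Quasi

variable {d : ℕ}

/-- Floquet boundary conditions with multipliers `z`. -/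
def QuasiPer (q : Fin d → ℕ+) (z : Fin d → ℂ) (u : (Fin d → ℤ) → ℂ) : Prop :=
  ∀ (n : Fin d → ℤ) (j : Fin d), u (Function.update n j (n j + ((q j : ℕ) : ℤ))) = z j * u n

/-- Existence of a nonzero Floquet solution with multipliers `z` and energy `lam`. -/
def Bloch (q : Fin d → ℕ+) (V : (Fin d → ℤ) → ℂ) (z : Fin d → ℂ) (lam : ℂ) : Prop :=
  ∃ u : (Fin d → ℤ) → ℂ, u ≠ 0 ∧ (∀ n, -(discLap u n) + V n * u n = lam * u n) ∧ QuasiPer q z u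

lemma QuasiPer.add_nat_mul {q : Fin d → ℕ+} {z : Fin d → ℂ} {u : (Fin d → ℤ) → ℂ}
    (h : QuasiPer q z u) (n : Fin d → ℤ) (j : Fin d) (m : ℕ) :
    u (Function.update n j (n j + m * ((q j : ℕ) : ℤ))) = z j ^ m * u n := by
  induction m with
  | zero => simp
  | succ m ih =>
    have := h (Function.update n j (n j + m * ((q j : ℕ) : ℤ))) j
    rw [ih, Function.update_idem, Function.update_self] at this
    rw [pow_succ', mul_assoc, ← this]
    congr 2
    push_cast; ring

lemma QuasiPer.add_int_mul {q : Fin d → ℕ+} {z : Fin d → ℂ} {u : (Fin d → ℤ) → ℂ}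
    (h : QuasiPer q z u) (hz : ∀ j, z j ≠ 0) (n : Fin d → ℤ) (j : Fin d) (m : ℤ) :
    u (Function.update n j (n j + m * ((q j : ℕ) : ℤ))) = z j ^ m * u n := by
  obtain ⟨k, rfl | rfl⟩ := m.eq_nat_or_neg
  · simpa using h.add_nat_mul n j k
  · have := h.add_nat_mul (Function.update n j (n j + -(k : ℤ) * ((q j : ℕ) : ℤ))) j k
    rw [Function.update_idem, Function.update_self] at this
    have h2 : n j + -(k : ℤ) * ((q j : ℕ) : ℤ) + k * ((q j : ℕ) : ℤ) = n j := by ring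
    rw [h2, Function.update_eq_self] at this
    rw [this, zpow_neg, zpow_natCast]
    have := pow_ne_zero k (hz j)
    field_simp

lemma QuasiPer.eq_emod {q : Fin d → ℕ+} {z : Fin d → ℂ} {u : (Fin d → ℤ) → ℂ}
    (h : QuasiPer q z u) (hz : ∀ j, z j ≠ 0) (n : Fin d → ℤ) :
    u n = (∏ j, z j ^ (n j / ((q j : ℕ) : ℤ))) * u (fun j => n j % ((q j : ℕ) : ℤ)) := by
  have key : ∀ s : Finset (Fin d), u n = (∏ j ∈ s, z j ^ (n j / ((q j : ℕ) : ℤ))) *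
      u (fun j => if j ∈ s then n j % ((q j : ℕ) : ℤ) else n j) := by
    intro s
    induction s using Finset.induction_on with
    | empty => simp
    | insert a s ha ih =>
      rw [Finset.prod_insert ha, ih]
      have := h.add_int_mul hz
        (fun j => if j ∈ insert a s then n j % ((q j : ℕ) : ℤ) else n j) a
        (n a / ((q a : ℕ) : ℤ))
      have h2 : Function.update
          (fun j => if j ∈ insert a s then n j % ((q j : ℕ) : ℤ) else n j) a
          ((fun j => if j ∈ insert a s then n j % ((q j : ℕ) : ℤ) else n j) a
            + n a / ((q a : ℕ) : ℤ) * ((q a : ℕ) : ℤ))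
          = fun j => if j ∈ s then n j % ((q j : ℕ) : ℤ) else n j := by
        funext j
        by_cases hj : j = a
        · subst hj
          simp only [Function.update_self, Finset.mem_insert_self, if_true, ha, if_false]
          rw [mul_comm]; exact Int.emod_add_mul_ediv _ _
        · simp [hj]
      rw [h2] at this
      rw [this]; ring
  simpa using key Finset.univ

lemma fem_coe (q : ℕ+) (a : ℤ) : (((fem q a : Fin (q : ℕ)) : ℕ) : ℤ) = a % ((q : ℕ) : ℤ) := by
  have hq : (0:ℤ) < ((q : ℕ) : ℤ) := by exact_mod_cast q.pos
  exact Int.toNat_of_nonneg (Int.emod_nonneg a hq.ne')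

lemma fem_natCast (q : ℕ+) (a : Fin (q : ℕ)) : fem q ((a : ℕ) : ℤ) = a := by
  have h := fem_coe q ((a : ℕ) : ℤ)
  rw [Int.emod_eq_of_lt (by positivity) (by exact_mod_cast a.2)] at h
  exact Fin.ext (by exact_mod_cast h)

lemma natCast_ediv_eq_zero (q : ℕ+) (a : Fin (q : ℕ)) : ((a : ℕ) : ℤ) / ((q : ℕ) : ℤ) = 0 :=
  Int.ediv_eq_zero_of_lt (by positivity) (by exact_mod_cast a.2)

lemma QuasiPer.eq_extendBC {q : Fin d → ℕ+} {z : Fin d → ℂ} {u : (Fin d → ℤ) → ℂ}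
    (h : QuasiPer q z u) (hz : ∀ j, z j ≠ 0) :
    u = extendBC q z (fun x => u (fun j => ((x j : ℕ) : ℤ))) := by
  funext n
  rw [h.eq_emod hz n, extendBC]
  simp only [fem_coe]

lemma extendBC_quasiPer (q : Fin d → ℕ+) (z : Fin d → ℂ) (hz : ∀ j, z j ≠ 0)
    (f : (∀ j, Fin ((q j : ℕ))) → ℂ) : QuasiPer q z (extendBC q z f) := by
  intro n j
  have hq : ((q j : ℕ) : ℤ) ≠ 0 := by exact_mod_cast (q j).pos.ne'
  unfold extendBC
  have h1 : (fun i => fem (q i) (Function.update n j (n j + ((q j : ℕ) : ℤ)) i))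
      = fun i => fem (q i) (n i) := by
    funext i
    by_cases hi : i = j
    · subst hi
      apply Fin.ext
      have := fem_coe (q i) (n i + ((q i : ℕ) : ℤ))
      rw [Int.add_emod_right, ← fem_coe] at this
      rw [Function.update_self]
      exact_mod_cast this
    · rw [Function.update_of_ne hi]
  rw [h1, ← mul_assoc]
  congr 1
  rw [← Finset.mul_prod_erase _ _ (Finset.mem_univ j),
    ← Finset.mul_prod_erase (a := j) univ (fun j => z j ^ (n j / ((q j : ℕ) : ℤ))) (Finset.mem_univ j),
    Function.update_self,
    Int.add_ediv_of_dvd_right (dvd_refl _), Int.ediv_self hq, zpow_add_one₀ (hz j)]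
  have : ∏ i ∈ univ.erase j, z i ^ (Function.update n j (n j + ((q j : ℕ) : ℤ)) i / ((q i : ℕ) : ℤ))
      = ∏ i ∈ univ.erase j, z i ^ (n i / ((q i : ℕ) : ℤ)) :=
    Finset.prod_congr rfl fun i hi => by
      rw [Function.update_of_ne (Finset.ne_of_mem_erase hi)]
  rw [this]; ring

lemma extendBC_natCast (q : Fin d → ℕ+) (z : Fin d → ℂ) (f : (∀ j, Fin ((q j : ℕ))) → ℂ)
    (x : ∀ j, Fin ((q j : ℕ))) : extendBC q z f (fun j => ((x j : ℕ) : ℤ)) = f x := by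
  simp [extendBC, fem_natCast, natCast_ediv_eq_zero]

lemma DVmat_mulVec (q : Fin d → ℕ+) (V : (Fin d → ℤ) → ℂ) (z : Fin d → ℂ)
    (f : (∀ j, Fin ((q j : ℕ))) → ℂ) (x : ∀ j, Fin ((q j : ℕ))) :
    (DVmat q V z).mulVec f x = -(discLap (extendBC q z f) (fun j => ((x j : ℕ) : ℤ)))
      + V (fun j => ((x j : ℕ) : ℤ)) * f x := by
  have hE : ∀ n, extendBC q z f n = ∑ y, extendBC q z (Pi.single y 1) n * f y := by
    intro n
    simp [extendBC, Pi.single_apply]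
  have hD : ∀ n, discLap (extendBC q z f) n
      = ∑ y, discLap (extendBC q z (Pi.single y 1)) n * f y := by
    intro n
    simp only [discLap, Finset.sum_mul]
    rw [Finset.sum_comm]
    refine Finset.sum_congr rfl fun j _ => ?_
    rw [hE, hE, ← Finset.sum_add_distrib]
    exact Finset.sum_congr rfl fun y _ => by ring
  simp only [Matrix.mulVec, dotProduct, DVmat, add_mul, neg_mul, Finset.sum_add_distrib,
    Finset.sum_neg_distrib, hD]
  simp

lemma discLap_quasiPer {q : Fin d → ℕ+} {z : Fin d → ℂ} {u : (Fin d → ℤ) → ℂ}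
    (h : QuasiPer q z u) : QuasiPer q z (discLap u) := by
  intro n j
  simp only [discLap, Finset.mul_sum, mul_add]
  refine Finset.sum_congr rfl fun i _ => ?_
  by_cases hi : i = j
  · subst hi
    have h1 := h (Function.update n i (n i + 1)) i
    have h2 := h (Function.update n i (n i - 1)) i
    simp only [Function.update_self, Function.update_idem] at h1 h2 ⊢
    rw [← h1, ← h2]
    congr 3 <;> ring
  · have h1 := h (Function.update n i (n i + 1)) j
    have h2 := h (Function.update n i (n i - 1)) j
    rw [Function.update_of_ne (Ne.symm hi), Function.update_comm hi] at h1 h2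
    rw [Function.update_of_ne hi, h1, h2]

lemma mem_spectrum_DVmat_iff {q : Fin d → ℕ+} {V : (Fin d → ℤ) → ℂ} (hV : IsPeriodic q V)
    {z : Fin d → ℂ} (hz : ∀ j, z j ≠ 0) (lam : ℂ) :
    lam ∈ spectrum ℂ (DVmat q V z) ↔ Bloch q V z lam := by
  rw [← Matrix.spectrum_toLin', ← Module.End.hasEigenvalue_iff_mem_spectrum]
  constructor
  · intro h
    obtain ⟨f, hf, hf0⟩ := h.exists_hasEigenvector
    rw [Module.End.mem_eigenspace_iff, Matrix.toLin'_apply] at hf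
    refine ⟨extendBC q z f, fun h0 => hf0 ?_, ?_, extendBC_quasiPer q z hz f⟩
    · funext x
      rw [← extendBC_natCast q z f x, h0]; rfl
    · have hE := extendBC_quasiPer q z hz f
      have hL := discLap_quasiPer hE
      set g : (Fin d → ℤ) → ℂ := fun n => -(discLap (extendBC q z f) n)
        + V n * extendBC q z f n - lam * extendBC q z f n with hg
      have hgq : QuasiPer q z g := by
        intro n j
        simp only [hg]
        rw [hE n j, hL n j, hV n j]; ring
      have hg0 : (fun x : ∀ j, Fin ((q j : ℕ)) => g (fun j => ((x j : ℕ) : ℤ))) = 0 := by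
        funext x
        have h1 := congrFun hf x
        rw [DVmat_mulVec] at h1
        simp only [hg, extendBC_natCast]
        rw [h1]; simp
      intro n
      have h2 := congrFun (hgq.eq_extendBC hz) n
      rw [hg0] at h2
      simp only [extendBC, Pi.zero_apply, mul_zero] at h2
      exact sub_eq_zero.mp h2
  · rintro ⟨u, hu0, hu, huq⟩
    have he := huq.eq_extendBC hz
    apply Module.End.hasEigenvalue_of_hasEigenvector
      (x := fun x : ∀ j, Fin ((q j : ℕ)) => u (fun j => ((x j : ℕ) : ℤ)))
    refine ⟨?_, fun h0 => hu0 ?_⟩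
    · rw [Module.End.mem_eigenspace_iff, Matrix.toLin'_apply]
      funext x
      rw [DVmat_mulVec, ← he]
      exact hu _
    · rw [he, h0]
      funext n
      simp [extendBC]

/-- A function on `ℤ^d` restricted to representatives of `ℤ^d / Γ`. -/
def toTorus (q : Fin d → ℕ+) (V : (Fin d → ℤ) → ℂ) (x : ∀ j, ZMod (q j : ℕ)) : ℂ :=
  V (fun j => ((x j).val : ℤ))

lemma toTorus_intCast {q : Fin d → ℕ+} {V : (Fin d → ℤ) → ℂ} (hV : IsPeriodic q V)
    (n : Fin d → ℤ) : toTorus q V (fun j => (n j : ZMod (q j : ℕ))) = V n := by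
  have h : QuasiPer q (fun _ => 1) V := fun n j => by rw [one_mul]; exact hV n j
  rw [h.eq_emod (fun _ => one_ne_zero) n]
  simp only [toTorus, ZMod.val_intCast, one_zpow, Finset.prod_const_one, one_mul]

/-- The coordinate generators of the discrete torus. -/
def torusStep (q : Fin d → ℕ+) (j : Fin d) : ∀ i, ZMod (q i : ℕ) := Pi.single j 1

lemma intCast_update_add (q : Fin d → ℕ+) (n : Fin d → ℤ) (j : Fin d) (m : ℤ) :
    (fun i => ((Function.update n j (n j + m) i : ℤ) : ZMod (q i : ℕ)))
      = (fun i => (n i : ZMod (q i : ℕ))) + m • torusStep q j := by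
  funext i
  by_cases hi : i = j
  · subst hi; simp [torusStep]
  · simp [torusStep, hi]

lemma exists_intCast_eq (q : Fin d → ℕ+) (x : ∀ i, ZMod (q i : ℕ)) :
    ∃ n : Fin d → ℤ, (fun i => (n i : ZMod (q i : ℕ))) = x :=
  ⟨fun i => (x i).val, by funext i; simp⟩

lemma Bloch.exists_torusEq {q : Fin d → ℕ+} {V : (Fin d → ℤ) → ℂ} (hV : IsPeriodic q V)
    {z w : Fin d → ℂ} (hw : ∀ j, w j ≠ 0) (hwz : ∀ j, w j ^ (q j : ℕ) = z j) {lam : ℂ}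
    (h : Bloch q V z lam) :
    ∃ v : (∀ j, ZMod (q j : ℕ)) → ℂ, v ≠ 0 ∧ TorusEq (torusStep q) w (toTorus q V) lam v := by
  obtain ⟨u, hu0, hu, huq⟩ := h
  have hupd : ∀ (n : Fin d → ℤ) (j : Fin d) (m : ℤ),
      ∏ i, w i ^ (Function.update n j (n j + m) i) = w j ^ m * ∏ i, w i ^ (n i) := by
    intro n j m
    rw [← Finset.mul_prod_erase _ _ (Finset.mem_univ j),
      ← Finset.mul_prod_erase (a := j) univ (fun i => w i ^ (n i)) (Finset.mem_univ j),
      Function.update_self, zpow_add₀ (hw j)]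
    have : ∏ i ∈ univ.erase j, w i ^ (Function.update n j (n j + m) i)
        = ∏ i ∈ univ.erase j, w i ^ (n i) :=
      Finset.prod_congr rfl fun i hi => by
        rw [Function.update_of_ne (Finset.ne_of_mem_erase hi)]
    rw [this]; ring
  have hP : ∀ n : Fin d → ℤ, ∏ i, w i ^ (n i) ≠ 0 := fun n =>
    Finset.prod_ne_zero_iff.mpr fun i _ => zpow_ne_zero _ (hw i)
  set g : (Fin d → ℤ) → ℂ := fun n => (∏ i, w i ^ (n i))⁻¹ * u n with hg
  have hgu : ∀ n, u n = (∏ i, w i ^ (n i)) * g n := fun n => by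
    simp only [hg]; rw [mul_inv_cancel_left₀ (hP n)]
  have hgp : IsPeriodic q g := by
    intro n j
    simp only [hg]
    rw [hupd, huq n j, zpow_natCast, hwz]
    have hzj : z j ≠ 0 := by rw [← hwz]; exact pow_ne_zero _ (hw j)
    rw [mul_inv]; field_simp
  refine ⟨toTorus q g, fun h0 => hu0 ?_, fun x => ?_⟩
  · funext n
    rw [hgu n, ← toTorus_intCast hgp n, h0]; simp
  · obtain ⟨n, rfl⟩ := exists_intCast_eq q x
    have h1 : ∀ j, toTorus q g ((fun i => (n i : ZMod (q i : ℕ))) + torusStep q j)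
        = g (Function.update n j (n j + 1)) := fun j => by
      rw [← toTorus_intCast hgp, intCast_update_add, one_smul]
    have h2 : ∀ j, toTorus q g ((fun i => (n i : ZMod (q i : ℕ))) - torusStep q j)
        = g (Function.update n j (n j + -1)) := fun j => by
      rw [← toTorus_intCast hgp, intCast_update_add, neg_smul, one_smul, sub_eq_add_neg]
    simp only [h1, h2, toTorus_intCast hgp, toTorus_intCast hV]
    have h3 := hu n
    have h4 : discLap u n = (∏ i, w i ^ (n i)) *
        ∑ j, (w j * g (Function.update n j (n j + 1)) + (w j)⁻¹ * g (Function.update n j (n j + -1))) := by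
      rw [discLap, Finset.mul_sum]
      refine Finset.sum_congr rfl fun j _ => ?_
      rw [sub_eq_add_neg, hgu (Function.update n j (n j + 1)),
        hgu (Function.update n j (n j + -1)), hupd, hupd, zpow_one, zpow_neg_one]
      ring
    rw [h4, hgu n] at h3
    apply mul_left_cancel₀ (hP n)
    linear_combination h3

end Quasi

/-- Existence of a nonzero one-dimensional Floquet solution with multiplier `z`. -/
def BlochOne (q : ℕ+) (V : ℤ → ℂ) (z lam : ℂ) : Prop :=
  ∃ u : ℤ → ℂ, u ≠ 0 ∧ (∀ n, -(u (n + 1) + u (n - 1)) + V n * u n = lam * u n) ∧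
    ∀ n, u (n + ((q : ℕ) : ℤ)) = z * u n

lemma update_fin_one (n : Fin 1 → ℤ) (m : ℤ) : Function.update n 0 m = fun _ => m := by
  funext i
  rw [Subsingleton.elim i 0, Function.update_self]

lemma bloch_fin_one_iff (q : ℕ+) (V : ℤ → ℂ) (z lam : ℂ) :
    Bloch (fun _ : Fin 1 => q) (fun n => V (n 0)) (fun _ => z) lam ↔ BlochOne q V z lam := by
  constructor
  · rintro ⟨u, hu0, hu, huq⟩
    refine ⟨fun m => u (fun _ => m), fun h => hu0 ?_, fun m => ?_, fun m => ?_⟩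
    · funext n
      have := congrFun h (n 0)
      rw [Pi.zero_apply] at this ⊢
      rw [← this]; congr 1; funext i; rw [Subsingleton.elim i 0]
    · simpa [discLap, update_fin_one] using hu (fun _ => m)
    · simpa [update_fin_one] using huq (fun _ => m) 0
  · rintro ⟨u, hu0, hu, huq⟩
    refine ⟨fun n => u (n 0), fun h => hu0 ?_, fun n => ?_, fun n j => ?_⟩
    · funext m
      exact congrFun h (fun _ => m)
    · simpa [discLap, update_fin_one] using hu (n 0)
    · rw [Subsingleton.elim j 0]
      simpa using huq (n 0)

lemma isPeriodic_fin_one {q : ℕ+} {V : ℤ → ℂ} (hV : ∀ n, V (n + ((q : ℕ) : ℤ)) = V n) :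
    IsPeriodic (fun _ : Fin 1 => q) (fun n => V (n 0)) := by
  intro n j
  rw [Subsingleton.elim j 0]
  simpa using hV (n 0)

lemma finite_setOf_blochOne {q : ℕ+} {V : ℤ → ℂ} (hV : ∀ n, V (n + ((q : ℕ) : ℤ)) = V n)
    {z : ℂ} (hz : z ≠ 0) : {lam | BlochOne q V z lam}.Finite := by
  have h : {lam | BlochOne q V z lam}
      = spectrum ℂ (DVmat (fun _ : Fin 1 => q) (fun n => V (n 0)) (fun _ => z)) := by
    ext lam
    rw [mem_spectrum_DVmat_iff (isPeriodic_fin_one hV) (fun _ => hz), bloch_fin_one_iff]; rfl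
  rw [h]
  exact Matrix.finite_spectrum _

lemma exists_multiplier (t : ℂ) : ∃ z : ℂ, 1 ≤ ‖z‖ ∧ z * z - t * z + 1 = 0 := by
  obtain ⟨s, hs⟩ := IsAlgClosed.exists_pow_nat_eq (t ^ 2 - 4) (n := 2) (by norm_num)
  have h1 : ((t + s) / 2) * ((t - s) / 2) = 1 := by linear_combination (-1 / 4) * hs
  have h2 : ‖(t + s) / 2‖ * ‖(t - s) / 2‖ = 1 := by rw [← norm_mul, h1, norm_one]
  rcases le_total 1 ‖(t + s) / 2‖ with h | h
  · exact ⟨_, h, by linear_combination (1 / 4) * hs⟩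
  · refine ⟨(t - s) / 2, ?_, by linear_combination (1 / 4) * hs⟩
    nlinarith [norm_nonneg ((t - s) / 2)]

/-- Transfer matrices of the one-dimensional equation. -/
def transfer (V : ℤ → ℂ) (lam : ℂ) : ℕ → Matrix (Fin 2) (Fin 2) ℂ
  | 0 => 1
  | n + 1 => !![V n - lam, -1; 1, 0] * transfer V lam n

lemma det_transfer (V : ℤ → ℂ) (lam : ℂ) (n : ℕ) : (transfer V lam n).det = 1 := by
  induction n with
  | zero => simp [transfer]
  | succ n ih => rw [transfer, Matrix.det_mul, ih, Matrix.det_fin_two_of]; simp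

lemma exists_blochOne {q : ℕ+} {V : ℤ → ℂ} (hV : ∀ n, V (n + ((q : ℕ) : ℤ)) = V n) (lam : ℂ) :
    ∃ z : ℂ, 1 ≤ ‖z‖ ∧ BlochOne q V z lam := by
  set T := transfer V lam with hT
  obtain ⟨z, hz1, hz⟩ := exists_multiplier (T q).trace
  have hz0 : z ≠ 0 := by rintro rfl; norm_num at hz1
  refine ⟨z, hz1, ?_⟩
  have hdet : (T q - z • (1 : Matrix (Fin 2) (Fin 2) ℂ)).det = 0 := by
    have h1 := det_transfer V lam q
    rw [← hT, Matrix.det_fin_two] at h1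
    rw [Matrix.trace_fin_two] at hz
    rw [Matrix.det_fin_two]
    simp
    linear_combination hz + h1
  obtain ⟨x, hx0, hx⟩ := Matrix.exists_mulVec_eq_zero_iff.mpr hdet
  rw [Matrix.sub_mulVec, Matrix.smul_mulVec, Matrix.one_mulVec, sub_eq_zero] at hx
  set M : ℤ → Matrix (Fin 2) (Fin 2) ℂ := fun n => !![V n - lam, -1; 1, 0] with hM
  have hMper : ∀ (n : ℤ) (N : ℕ), M (n + N * ((q : ℕ) : ℤ)) = M n := by
    intro n N
    induction N with
    | zero => simp
    | succ N ih =>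
      rw [← ih]
      simp only [hM]
      rw [← hV (n + N * ((q : ℕ) : ℤ))]
      congr 5
      push_cast; ring
  set U : ℕ → Fin 2 → ℂ := fun n => (T n).mulVec x with hU
  have hUs : ∀ n : ℕ, U (n + 1) = (M n).mulVec (U n) := fun n => by
    simp only [hU, hT, transfer, hM, Matrix.mulVec_mulVec]
  have hUq : ∀ n : ℕ, U (n + q) = z • U n := by
    intro n
    induction n with
    | zero => simp only [zero_add, hU, hT, transfer, Matrix.one_mulVec]; exact hx
    | succ n ih =>
      have h1 := hMper n 1
      rw [add_right_comm, hUs, ih, hUs, Matrix.mulVec_smul]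
      push_cast at h1 ⊢
      rw [one_mul] at h1
      rw [h1]
  have hUN : ∀ (n N : ℕ), U (n + N * q) = z ^ N • U n := by
    intro n N
    induction N with
    | zero => simp
    | succ N ih => rw [add_mul, one_mul, ← add_assoc, hUq, ih, smul_smul, pow_succ']
  have hqpos : (1 : ℤ) ≤ ((q : ℕ) : ℤ) := by exact_mod_cast q.pos
  set E : ℤ → Fin 2 → ℂ := fun n =>
    (z ^ n.natAbs)⁻¹ • U (n + n.natAbs * ((q : ℕ) : ℤ)).toNat with hE
  have hnn : ∀ n : ℤ, 0 ≤ n + n.natAbs * ((q : ℕ) : ℤ) := fun n => by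
    have h1 : (n.natAbs : ℤ) ≤ n.natAbs * ((q : ℕ) : ℤ) := by
      nlinarith [Int.natCast_nonneg n.natAbs]
    omega
  have hEeq : ∀ (n : ℤ) (N k : ℕ), (k : ℤ) = n + N * ((q : ℕ) : ℤ) → E n = (z ^ N)⁻¹ • U k := by
    intro n N k hk
    have h1 : (n + n.natAbs * ((q : ℕ) : ℤ)).toNat + N * q = k + n.natAbs * q := by
      apply Nat.cast_injective (R := ℤ)
      simp only [Nat.cast_add, Nat.cast_mul]
      rw [Int.toNat_of_nonneg (hnn n), hk]
      ring
    have h2 := hUN (n + n.natAbs * ((q : ℕ) : ℤ)).toNat N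
    rw [h1, hUN] at h2
    have hzN := pow_ne_zero N hz0
    have hzn := pow_ne_zero n.natAbs hz0
    rw [inv_smul_eq_iff₀ hzn, smul_comm, h2, inv_smul_smul₀ hzN]
  have hEs : ∀ n : ℤ, E (n + 1) = (M n).mulVec (E n) := by
    intro n
    have hk := Int.toNat_of_nonneg (hnn n)
    rw [hEeq n _ _ hk, hEeq (n + 1) n.natAbs ((n + n.natAbs * ((q : ℕ) : ℤ)).toNat + 1)
      (by simp only [Nat.cast_add, Nat.cast_one]; rw [hk]; ring), hUs, Matrix.mulVec_smul, hk, hMper]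
  have hEq : ∀ n : ℤ, E (n + ((q : ℕ) : ℤ)) = z • E n := by
    intro n
    have hk := Int.toNat_of_nonneg (hnn n)
    rw [hEeq n _ _ hk, hEeq (n + ((q : ℕ) : ℤ)) n.natAbs ((n + n.natAbs * ((q : ℕ) : ℤ)).toNat + q)
      (by simp only [Nat.cast_add]; rw [hk]; ring), hUq, smul_comm]
  have hE1 : ∀ n : ℤ, E n 1 = E (n - 1) 0 := fun n => by
    have := congrFun (hEs (n - 1)) 1
    rw [sub_add_cancel] at this
    simpa [hM, Matrix.mulVec, dotProduct, Fin.sum_univ_two] using this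
  refine ⟨fun n => E n 0, fun h => hx0 ?_, fun n => ?_, fun n => ?_⟩
  · have h0 : ∀ n, E n 0 = 0 := fun n => congrFun h n
    have hEx : E 0 = x := by
      rw [hEeq 0 0 0 (by simp), pow_zero, inv_one, one_smul]
      simp only [hU, hT, transfer, Matrix.one_mulVec]
    rw [← hEx]
    funext i
    fin_cases i
    · exact h0 0
    · exact (hE1 0).trans (h0 _)
  · have := congrFun (hEs n) 0
    simp only [hM, Matrix.mulVec, dotProduct, Fin.sum_univ_two] at this
    simp at this
    dsimp only
    rw [this, hE1]; ring
  · simpa using congrFun (hEq n) 0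

lemma bloch_of_blochOne {d : ℕ} {q : Fin d → ℕ+} {V : Fin d → ℤ → ℂ} {z μ : Fin d → ℂ}
    (h : ∀ j, BlochOne (q j) (V j) (z j) (μ j)) :
    Bloch q (fun n => ∑ j, V j (n j)) z (∑ j, μ j) := by
  choose u hu0 hu huq using h
  have hupd : ∀ (n : Fin d → ℤ) (j : Fin d) (m : ℤ),
      ∏ i, u i (Function.update n j m i) = u j m * ∏ i ∈ univ.erase j, u i (n i) := by
    intro n j m
    rw [← Finset.mul_prod_erase _ _ (Finset.mem_univ j), Function.update_self]
    congr 1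
    exact Finset.prod_congr rfl fun i hi => by
      rw [Function.update_of_ne (Finset.ne_of_mem_erase hi)]
  have hself : ∀ (n : Fin d → ℤ) (j : Fin d),
      ∏ i, u i (n i) = u j (n j) * ∏ i ∈ univ.erase j, u i (n i) := fun n j => by
    rw [Finset.mul_prod_erase univ (fun i => u i (n i)) (Finset.mem_univ j)]
  refine ⟨fun n => ∏ j, u j (n j), fun h => ?_, fun n => ?_, fun n j => ?_⟩
  · have : ∀ j, ∃ m, u j m ≠ 0 := fun j => Function.ne_iff.mp (hu0 j)
    choose m hm using this
    exact Finset.prod_ne_zero_iff.mpr (fun j _ => hm j) (congrFun h m)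
  · simp only [discLap]
    rw [Finset.sum_mul, Finset.sum_mul, ← Finset.sum_neg_distrib, ← Finset.sum_add_distrib]
    refine Finset.sum_congr rfl fun j _ => ?_
    rw [hupd, hupd, hself n j]
    linear_combination (∏ i ∈ univ.erase j, u i (n i)) * hu j (n j)
  · simp only
    rw [hupd, huq, hself n j]; ring

/-- A commuting family of endomorphisms has a common eigenvector in every nonzero invariant
subspace. -/
lemma exists_common_eigenvector {ι M : Type*} [AddCommGroup M] [Module ℂ M]
    [FiniteDimensional ℂ M] (f : ι → Module.End ℂ M)
    (hf : ∀ i j, Commute (f i) (f j)) (s : Finset ι) (p : Submodule ℂ M) (hp : p ≠ ⊥)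
    (hinv : ∀ i, ∀ x ∈ p, f i x ∈ p) :
    ∃ v ∈ p, v ≠ 0 ∧ ∀ i ∈ s, ∃ ν : ℂ, f i v = ν • v := by
  classical
  induction s using Finset.induction_on generalizing p with
  | empty =>
    obtain ⟨v, hv, hv0⟩ := Submodule.exists_mem_ne_zero_of_ne_bot hp
    exact ⟨v, hv, hv0, by simp⟩
  | insert a s ha ih =>
    have : Nontrivial p := Submodule.nontrivial_iff_ne_bot.mpr hp
    obtain ⟨c, hc⟩ := Module.End.exists_eigenvalue ((f a).restrict (hinv a))
    obtain ⟨y, hy, hy0⟩ := hc.exists_hasEigenvector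
    rw [Module.End.mem_eigenspace_iff] at hy
    have hy' : f a y = c • (y : M) := by
      simpa using congrArg Subtype.val hy
    obtain ⟨v, hv, hv0, hvs⟩ := ih (p ⊓ (f a).eigenspace c)
      (fun h => hy0 (by
        have : (y : M) ∈ p ⊓ (f a).eigenspace c :=
          ⟨y.2, Module.End.mem_eigenspace_iff.mpr hy'⟩
        rw [h, Submodule.mem_bot] at this
        exact Subtype.ext this))
      (fun i x hx => ⟨hinv i x hx.1, by
        have h1 := Module.End.mem_eigenspace_iff.mp hx.2
        change f i x ∈ (f a).eigenspace c
        rw [Module.End.mem_eigenspace_iff]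
        have h2 := congrArg (fun g : Module.End ℂ M => g x) (hf a i)
        simp only [Module.End.mul_apply] at h2
        rw [h2, h1, map_smul]⟩)
    refine ⟨v, hv.1, hv0, fun i hi => ?_⟩
    rcases Finset.mem_insert.mp hi with rfl | hi
    · exact ⟨c, Module.End.mem_eigenspace_iff.mp hv.2⟩
    · exact hvs i hi

lemma periodic_emod {q : ℕ+} {V : ℤ → ℂ} (hV : ∀ n, V (n + ((q : ℕ) : ℤ)) = V n) (m : ℤ) :
    V (m % ((q : ℕ) : ℤ)) = V m := by
  have h : Function.Periodic V ((q : ℕ) : ℤ) := hV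
  have h2 := h.sub_zsmul_eq (x := m) (m / ((q : ℕ) : ℤ))
  rw [← h2, smul_eq_mul, Int.emod_def, mul_comm]

section Split

variable {d : ℕ}

/-- The one-dimensional Floquet operators acting on functions on the torus. -/
def coordOp (q : Fin d → ℕ+) (V : Fin d → ℤ → ℂ) (w : Fin d → ℂ) (j : Fin d) :
    Module.End ℂ ((∀ i, ZMod (q i : ℕ)) → ℂ) where
  toFun v x := -(w j * v (x + torusStep q j) + (w j)⁻¹ * v (x - torusStep q j))
    + V j ((x j).val) * v x
  map_add' u v := by
    funext x
    simp only [Pi.add_apply]; ring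
  map_smul' c v := by
    funext x
    simp only [Pi.smul_apply, smul_eq_mul, RingHom.id_apply]; ring

lemma coordOp_apply (q : Fin d → ℕ+) (V : Fin d → ℤ → ℂ) (w : Fin d → ℂ) (j : Fin d)
    (v : (∀ i, ZMod (q i : ℕ)) → ℂ) (x : ∀ i, ZMod (q i : ℕ)) :
    coordOp q V w j v x = -(w j * v (x + torusStep q j) + (w j)⁻¹ * v (x - torusStep q j))
      + V j ((x j).val) * v x := rfl

lemma coordOp_commute (q : Fin d → ℕ+) (V : Fin d → ℤ → ℂ) (w : Fin d → ℂ) (i j : Fin d) :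
    Commute (coordOp q V w i) (coordOp q V w j) := by
  by_cases hij : i = j
  · rw [hij]
  · refine LinearMap.ext fun v => funext fun x => ?_
    have hs : ∀ a b : Fin d, a ≠ b → torusStep q a b = 0 := fun a b hab => by
      rw [torusStep, Pi.single_eq_of_ne hab.symm]
    simp only [Module.End.mul_apply, coordOp_apply, Pi.add_apply, Pi.sub_apply, hs i j hij,
      hs j i (Ne.symm hij), add_zero, sub_zero]
    rw [add_right_comm x (torusStep q j), sub_add_eq_add_sub x (torusStep q j) (torusStep q i),
      sub_add_eq_add_sub x (torusStep q i) (torusStep q j),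
      sub_right_comm x (torusStep q j)]
    ring

lemma exists_root_coord (q : Fin d → ℕ+) (z : Fin d → ℂ) :
    ∃ w : Fin d → ℂ, ∀ j, w j ^ (q j : ℕ) = z j := by
  choose w hw using fun j => IsAlgClosed.exists_pow_nat_eq (z j) (q j).pos
  exact ⟨w, hw⟩

lemma ne_zero_of_pow_eq {q : ℕ+} {w z : ℂ} (h : w ^ (q : ℕ) = z) (hz : z ≠ 0) : w ≠ 0 := by
  rintro rfl
  exact hz (by rw [← h, zero_pow q.pos.ne'])

lemma isPeriodic_sum {q : Fin d → ℕ+} {V : Fin d → ℤ → ℂ}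
    (hV : ∀ j n, V j (n + ((q j : ℕ) : ℤ)) = V j n) : IsPeriodic q (fun n => ∑ j, V j (n j)) := by
  intro n j
  refine Finset.sum_congr rfl fun i _ => ?_
  by_cases hi : i = j
  · subst hi; rw [Function.update_self, hV]
  · rw [Function.update_of_ne hi]

/-- Floquet solutions for a separable potential split into one-dimensional ones. -/
lemma bloch_split {q : Fin d → ℕ+} {V : Fin d → ℤ → ℂ}
    (hV : ∀ j n, V j (n + ((q j : ℕ) : ℤ)) = V j n) {z : Fin d → ℂ} (hz : ∀ j, z j ≠ 0) {lam : ℂ}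
    (h : Bloch q (fun n => ∑ j, V j (n j)) z lam) :
    ∃ ν : Fin d → ℂ, ∑ j, ν j = lam ∧ ∀ j, BlochOne (q j) (V j) (z j) (ν j) := by
  obtain ⟨w, hwz⟩ := exists_root_coord q z
  have hw : ∀ j, w j ≠ 0 := fun j => ne_zero_of_pow_eq (hwz j) (hz j)
  obtain ⟨v, hv0, hv⟩ := h.exists_torusEq (isPeriodic_sum hV) hw hwz
  set H := coordOp q V w with hH
  have hvH : (∑ j, H j) v = lam • v := by
    funext x
    rw [Pi.smul_apply, smul_eq_mul, ← hv x, LinearMap.sum_apply, Finset.sum_apply]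
    simp only [hH, coordOp_apply, Finset.sum_add_distrib, Finset.sum_neg_distrib, toTorus,
      Finset.sum_mul]
  have hcomm : ∀ i, Commute (∑ j, H j) (H i) := fun i =>
    Commute.sum_left _ _ _ fun j _ => coordOp_commute q V w j i
  obtain ⟨v', hv', hv'0, hνe⟩ := exists_common_eigenvector H (coordOp_commute q V w) Finset.univ
    ((∑ j, H j).eigenspace lam)
    (fun h => hv0 (by
      have : v ∈ (∑ j, H j).eigenspace lam := Module.End.mem_eigenspace_iff.mpr hvH
      rwa [h, Submodule.mem_bot] at this))
    (fun i x hx => by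
      rw [Module.End.mem_eigenspace_iff] at hx ⊢
      have h2 := congrArg (fun g : Module.End ℂ _ => g x) (hcomm i)
      simp only [Module.End.mul_apply] at h2
      rw [h2, hx, map_smul])
  choose! ν hν using hνe
  obtain ⟨x0, hx0⟩ := Function.ne_iff.mp hv'0
  refine ⟨ν, ?_, fun j => ?_⟩
  · rw [Module.End.mem_eigenspace_iff, LinearMap.sum_apply,
      Finset.sum_congr rfl hν, ← Finset.sum_smul] at hv'
    exact smul_left_injective ℂ hv'0 hv'
  · have hup : ∀ m k : ℤ, Function.update x0 j ((m + k : ℤ) : ZMod (q j : ℕ))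
        = Function.update x0 j (m : ZMod (q j : ℕ)) + k • torusStep q j := by
      intro m k
      funext i
      by_cases hi : i = j
      · subst hi; simp [torusStep]
      · simp [torusStep, hi]
    refine ⟨fun m => w j ^ m * v' (Function.update x0 j (m : ZMod (q j : ℕ))), fun h0 => hx0 ?_,
      fun m => ?_, fun m => ?_⟩
    · have := congrFun h0 ((x0 j).val : ℤ)
      have hc : (((x0 j).val : ℤ) : ZMod (q j : ℕ)) = x0 j := by
        rw [Int.cast_natCast, ZMod.natCast_zmod_val]
      rw [hc, Function.update_eq_self] at this
      exact (mul_eq_zero.mp this).resolve_left (zpow_ne_zero _ (hw j))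
    · have h1 := congrFun (hν j (Finset.mem_univ j)) (Function.update x0 j (m : ZMod (q j : ℕ)))
      rw [hH, coordOp_apply, Function.update_self, ZMod.val_intCast, periodic_emod (hV j)] at h1
      have h2 := hup m 1
      have h3 := hup m (-1)
      rw [one_smul] at h2
      rw [neg_smul, one_smul, ← sub_eq_add_neg, ← sub_eq_add_neg] at h3
      rw [← h2, ← h3, Pi.smul_apply, smul_eq_mul] at h1
      dsimp only
      rw [zpow_add_one₀ (hw j), zpow_sub_one₀ (hw j)]
      linear_combination w j ^ m * h1
    · dsimp only
      rw [zpow_add₀ (hw j), zpow_natCast, hwz]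
      have : ((m + ((q j : ℕ) : ℤ) : ℤ) : ZMod (q j : ℕ)) = m := by simp
      rw [this]; ring

end Split

section OneDim

/-- The mean value of a one-dimensional periodic potential. -/
def mean (q : ℕ+) (V : ℤ → ℂ) : ℂ :=
  fcoef (toTorus (fun _ : Fin 1 => q) fun n => V (n 0)) 1

lemma addChar_torus_fin_one_ext {q : ℕ+} {φ ψ : AddChar (∀ _ : Fin 1, ZMod (q : ℕ)) ℂ}
    (h : φ (torusStep (fun _ : Fin 1 => q) 0) = ψ (torusStep (fun _ : Fin 1 => q) 0)) : φ = ψ := by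
  ext x
  have hx : x = (x 0).val • torusStep (fun _ : Fin 1 => q) 0 := by
    funext i
    rw [Subsingleton.elim i 0]
    simp [torusStep]
  rw [hx, AddChar.map_nsmul_eq_pow, AddChar.map_nsmul_eq_pow, h]

lemma BlochOne.exists_coeff {q : ℕ+} {V : ℤ → ℂ} (hV : ∀ n, V (n + ((q : ℕ) : ℤ)) = V n)
    {z w lam : ℂ} (hw : w ≠ 0) (hwz : w ^ (q : ℕ) = z) (h : BlochOne q V z lam) :
    ∃ c : AddChar (∀ _ : Fin 1, ZMod (q : ℕ)) ℂ → ℂ, c ≠ 0 ∧ ∀ ψ,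
      (-(ψ (torusStep (fun _ : Fin 1 => q) 0) * w + (ψ (torusStep (fun _ : Fin 1 => q) 0) * w)⁻¹)
        - lam) * c ψ
      + ∑ φ, fcoef (toTorus (fun _ : Fin 1 => q) fun n => V (n 0)) (ψ / φ) * c φ = 0 := by
  rw [← bloch_fin_one_iff] at h
  obtain ⟨v, hv0, hv⟩ := h.exists_torusEq (isPeriodic_fin_one hV) (w := fun _ => w) (fun _ => hw)
    (fun _ => hwz)
  refine ⟨fcoef v, fcoef_ne_zero hv0, fun ψ => ?_⟩
  simpa [symb] using hv.fourier ψ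

lemma one_le_norm_of_pow {q : ℕ+} {w z : ℂ} (hwz : w ^ (q : ℕ) = z) (hz : 1 ≤ ‖z‖) : 1 ≤ ‖w‖ := by
  rw [← hwz, norm_pow] at hz
  exact (one_le_pow_iff_of_nonneg (norm_nonneg _) q.pos.ne').mp hz

lemma tendsto_norm_root {T : Type*} {l : Filter T} {q : ℕ+} {V : ℤ → ℂ}
    (hV : ∀ n, V (n + ((q : ℕ) : ℤ)) = V n) {z w μ : T → ℂ} (hz : ∀ n, 1 ≤ ‖z n‖)
    (hwz : ∀ n, w n ^ (q : ℕ) = z n) (hμ : Tendsto (fun n => ‖μ n‖) l atTop)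
    (h : ∀ n, BlochOne q V (z n) (μ n)) : Tendsto (fun n => ‖w n‖) l atTop := by
  obtain ⟨C, hC⟩ := exists_diag_le
    (fun ψ φ => fcoef (toTorus (fun _ : Fin 1 => q) fun n => V (n 0)) (ψ / φ))
  refine tendsto_atTop_mono (f := fun n => ‖μ n‖ + (-C - 1)) (fun n => ?_)
    (tendsto_atTop_add_const_right _ _ hμ)
  have h1 := one_le_norm_of_pow (hwz n) (hz n)
  have hw0 : w n ≠ 0 := norm_pos_iff.mp (by linarith)
  obtain ⟨c, hc0, hc⟩ := (h n).exists_coeff hV hw0 (hwz n)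
  obtain ⟨ψ, hψ⟩ := hC _ c hc0 hc
  set ζ := ψ (torusStep (fun _ : Fin 1 => q) 0) with hζ
  have hn : ‖ζ‖ = 1 := AddChar.norm_apply ψ _
  have h2 : μ n = -(-(ζ * w n + (ζ * w n)⁻¹) - μ n) - ζ * w n - (ζ * w n)⁻¹ := by ring
  have h3 : ‖(ζ * w n)⁻¹‖ ≤ 1 := by
    rw [norm_inv, norm_mul, hn, one_mul]; exact inv_le_one_of_one_le₀ h1
  have h4 : ‖μ n‖ ≤ ‖-(ζ * w n + (ζ * w n)⁻¹) - μ n‖ + ‖ζ * w n‖ + ‖(ζ * w n)⁻¹‖ := by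
    conv_lhs => rw [h2]
    refine (norm_sub_le _ _).trans (add_le_add_left ((norm_sub_le _ _).trans ?_) _)
    rw [norm_neg]
  rw [norm_mul, hn, one_mul] at h4
  linarith

lemma tendsto_add_root {l : Ultrafilter ℕ} {q : ℕ+} {V : ℤ → ℂ}
    (hV : ∀ n, V (n + ((q : ℕ) : ℤ)) = V n) {z w μ : ℕ → ℂ}
    (hw : Tendsto (fun n => ‖w n‖) l atTop) (hw0 : ∀ n, w n ≠ 0)
    (hwz : ∀ n, w n ^ (q : ℕ) = z n) (h : ∀ n, BlochOne q V (z n) (μ n)) :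
    ∃ ζ : ℂ, ζ ^ (q : ℕ) = 1 ∧ Tendsto (fun n => μ n + ζ * w n) l (𝓝 (mean q V)) := by
  classical
  set e := torusStep (fun _ : Fin 1 => q) 0 with he
  set B : AddChar (∀ _ : Fin 1, ZMod (q : ℕ)) ℂ → AddChar (∀ _ : Fin 1, ZMod (q : ℕ)) ℂ → ℂ :=
    fun ψ φ => fcoef (toTorus (fun _ : Fin 1 => q) fun n => V (n 0)) (ψ / φ) with hB
  choose c hc0 hc using fun n => (h n).exists_coeff hV (hw0 n) (hwz n)
  obtain ⟨C, hC⟩ := exists_diag_le B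
  have hex : ∀ᶠ n in l, ∃ ψ : AddChar (∀ _ : Fin 1, ZMod (q : ℕ)) ℂ,
      ‖-(ψ e * w n + (ψ e * w n)⁻¹) - μ n‖ ≤ C :=
    Eventually.of_forall fun n => hC _ (c n) (hc0 n) (hc n)
  rw [Ultrafilter.eventually_exists_iff] at hex
  obtain ⟨ψ, hψ⟩ := hex
  have hunit : ∀ φ : AddChar (∀ _ : Fin 1, ZMod (q : ℕ)) ℂ, φ e ≠ 0 := fun φ =>
    norm_pos_iff.mp (by rw [AddChar.norm_apply]; exact one_pos)
  have ht : Tendsto (fun n => ‖ψ e * w n‖) l atTop := by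
    simpa only [norm_mul, AddChar.norm_apply, one_mul] using hw
  have hti : Tendsto (fun n => (ψ e * w n)⁻¹) l (𝓝 0) := by
    rw [tendsto_zero_iff_norm_tendsto_zero]
    simp only [norm_inv]
    exact tendsto_inv_atTop_zero.comp ht
  have hα0 : Tendsto (fun n => (-(ψ e * w n + (ψ e * w n)⁻¹) - μ n) / (ψ e * w n)) l (𝓝 0) := by
    rw [tendsto_zero_iff_norm_tendsto_zero]
    have h1 : Tendsto (fun n => C * ‖(ψ e * w n)⁻¹‖) l (𝓝 0) := by
      simpa using hti.norm.const_mul C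
    refine squeeze_zero' (Eventually.of_forall fun _ => norm_nonneg _) ?_ h1
    filter_upwards [hψ] with n hn
    rw [div_eq_mul_inv, norm_mul]
    exact mul_le_mul_of_nonneg_right hn (norm_nonneg _)
  have key := tendsto_resonant (l := (l : Filter ℕ)) ψ B
    (fun n φ => -(φ e * w n + (φ e * w n)⁻¹) - μ n) c (fun n => ψ e * w n)
    (fun φ => 1 - φ e / ψ e) hc0 hc ht
    (fun φ hφ h0 => hφ (addChar_torus_fin_one_ext (by
      have := sub_eq_zero.mp h0
      exact ((eq_div_iff (hunit ψ)).mp this).symm.trans (one_mul _))))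
    (fun φ hφ => by
      have h1 : Tendsto (fun n => (1 - φ e / ψ e) + (1 - ψ e / φ e) *
          ((ψ e * w n)⁻¹ * (ψ e * w n)⁻¹) +
          (-(ψ e * w n + (ψ e * w n)⁻¹) - μ n) / (ψ e * w n)) l
          (𝓝 ((1 - φ e / ψ e) + (1 - ψ e / φ e) * (0 * 0) + 0)) :=
        (((hti.mul hti).const_mul _).const_add _).add hα0
      rw [mul_zero, mul_zero, add_zero, add_zero] at h1
      refine h1.congr fun n => ?_
      have := hunit φ; have := hunit ψ; have := hw0 n
      field_simp
      ring)
  refine ⟨ψ e, ?_, ?_⟩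
  · rw [← AddChar.map_nsmul_eq_pow]
    have : (q : ℕ) • e = 0 := by
      funext i
      simp [he]
    rw [this, AddChar.map_zero_eq_one]
  · have h1 := (hti.mul key).add hti
    rw [zero_mul, zero_add] at h1
    have h2 : Tendsto (fun n => mean q V -
        ((ψ e * w n)⁻¹ * (ψ e * w n * (-(ψ e * w n + (ψ e * w n)⁻¹) - μ n + B ψ ψ))
          + (ψ e * w n)⁻¹)) l (𝓝 (mean q V - 0)) := tendsto_const_nhds.sub h1
    rw [sub_zero] at h2
    refine h2.congr fun n => ?_
    have hBm : B ψ ψ = mean q V := by simp only [hB, div_self', mean]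
    rw [inv_mul_cancel_left₀ (mul_ne_zero (hunit ψ) (hw0 n)), hBm]
    ring

/-- Two potentials sharing large multipliers have asymptotically related energies. -/
lemma tendsto_energy_sub {l : Ultrafilter ℕ} {q : ℕ+} {V Y : ℤ → ℂ}
    (hV : ∀ n, V (n + ((q : ℕ) : ℤ)) = V n) (hY : ∀ n, Y (n + ((q : ℕ) : ℤ)) = Y n)
    {z μ ν : ℕ → ℂ} (hz : ∀ n, 1 ≤ ‖z n‖) (hμ : Tendsto (fun n => ‖μ n‖) l atTop)
    (h : ∀ n, BlochOne q V (z n) (μ n)) (h' : ∀ n, BlochOne q Y (z n) (ν n)) :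
    ∃ ζ : ℂ, ζ ^ (q : ℕ) = 1 ∧
      Tendsto (fun n => ν n - ζ * μ n) l (𝓝 (mean q Y - ζ * mean q V)) := by
  choose w hwz using fun n => IsAlgClosed.exists_pow_nat_eq (z n) q.pos
  have hw := tendsto_norm_root hV hz hwz hμ h
  have hw0 : ∀ n, w n ≠ 0 := fun n =>
    norm_pos_iff.mp (by linarith [one_le_norm_of_pow (hwz n) (hz n)])
  obtain ⟨ζ, hζ, h1⟩ := tendsto_add_root hV hw hw0 hwz h
  obtain ⟨ξ, hξ, h2⟩ := tendsto_add_root hY hw hw0 hwz h'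
  have hζ0 : ζ ≠ 0 := ne_zero_of_pow_eq hζ one_ne_zero
  refine ⟨ξ / ζ, by rw [div_pow, hζ, hξ, div_one], ?_⟩
  refine (h2.sub (h1.const_mul (ξ / ζ))).congr fun n => ?_
  field_simp
  ring

end OneDim

section Characters

variable {d : ℕ} {q : Fin d → ℕ+}

lemma torus_eq_sum_single (x : ∀ j, ZMod (q j : ℕ)) : x = ∑ j, (x j).val • torusStep q j := by
  funext i
  rw [Finset.sum_apply, Finset.sum_eq_single i]
  · simp [torusStep]
  · intro j _ hj; simp [torusStep, hj.symm]
  · simp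

lemma addChar_torus_apply (ψ : AddChar (∀ j, ZMod (q j : ℕ)) ℂ) (x : ∀ j, ZMod (q j : ℕ)) :
    ψ x = ∏ j, ψ (torusStep q j) ^ (x j).val := by
  conv_lhs => rw [torus_eq_sum_single x]
  induction (Finset.univ : Finset (Fin d)) using Finset.induction_on with
  | empty => simp
  | insert a s ha ih =>
    rw [Finset.sum_insert ha, Finset.prod_insert ha, AddChar.map_add_eq_mul, ih,
      AddChar.map_nsmul_eq_pow]

lemma addChar_torus_ext {φ ψ : AddChar (∀ j, ZMod (q j : ℕ)) ℂ}
    (h : ∀ j, φ (torusStep q j) = ψ (torusStep q j)) : φ = ψ := by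
  ext x
  rw [addChar_torus_apply φ, addChar_torus_apply ψ]
  simp only [h]

lemma addChar_torusStep_pow (ψ : AddChar (∀ j, ZMod (q j : ℕ)) ℂ) (j : Fin d) :
    ψ (torusStep q j) ^ (q j : ℕ) = 1 := by
  rw [← AddChar.map_nsmul_eq_pow]
  have : (q j : ℕ) • torusStep q j = 0 := by
    funext i
    by_cases hi : i = j
    · subst hi; simp [torusStep]
    · simp [torusStep, hi]
  rw [this, AddChar.map_zero_eq_one]

lemma eq_one_of_coprime_pow {a b : ℕ} (hab : Nat.Coprime a b) {ζ : ℂ} (ha : ζ ^ a = 1)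
    (hb : ζ ^ b = 1) : ζ = 1 := by
  have := pow_gcd_eq_one.mpr ⟨ha, hb⟩
  rwa [hab, pow_one] at this

lemma addChar_torusStep_eq (hq : ∀ i j, i ≠ j → Nat.Coprime (q i) (q j))
    (ψ : AddChar (∀ j, ZMod (q j : ℕ)) ℂ) {i j : Fin d} (hij : i ≠ j)
    (h : ψ (torusStep q i) = ψ (torusStep q j)) : ψ (torusStep q i) = 1 :=
  eq_one_of_coprime_pow (hq i j hij) (addChar_torusStep_pow ψ i)
    (h ▸ addChar_torusStep_pow ψ j)

/-- The linear form `a ↦ ∑ φ(e_j) a_j`. -/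
def charForm (q : Fin d → ℕ+) (φ : AddChar (∀ j, ZMod (q j : ℕ)) ℂ) :
    Module.Dual ℂ (Fin d → ℂ) :=
  ∑ j, φ (torusStep q j) • LinearMap.proj j

lemma charForm_apply (φ : AddChar (∀ j, ZMod (q j : ℕ)) ℂ) (a : Fin d → ℂ) :
    charForm q φ a = ∑ j, φ (torusStep q j) * a j := by
  simp [charForm, LinearMap.sum_apply]

lemma charForm_single (φ : AddChar (∀ j, ZMod (q j : ℕ)) ℂ) (i : Fin d) (c : ℂ) :
    charForm q φ (Pi.single i c) = φ (torusStep q i) * c := by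
  rw [charForm_apply, Finset.sum_eq_single i]
  · simp
  · intro j _ hj; simp [hj]
  · simp

lemma exists_third (hd : 3 ≤ d) (i j : Fin d) : ∃ k, k ≠ i ∧ k ≠ j := by
  have h : (({i, j} : Finset (Fin d))).card < (Finset.univ : Finset (Fin d)).card := by
    rw [Finset.card_univ, Fintype.card_fin]
    exact (Finset.card_le_two).trans_lt hd
  obtain ⟨k, -, hk⟩ := Finset.exists_mem_notMem_of_card_lt_card h
  simp only [Finset.mem_insert, Finset.mem_singleton, not_or] at hk
  exact ⟨k, hk⟩

/-- An affine map sending three distinct points of the unit circle into the unit circle is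
a rotation or constant. -/
lemma affine_unit_circle {α β p1 p2 p3 : ℂ} (h1 : ‖p1‖ = 1) (h2 : ‖p2‖ = 1) (h3 : ‖p3‖ = 1)
    (h12 : p1 ≠ p2) (h13 : p1 ≠ p3) (h23 : p2 ≠ p3) (f1 : ‖α + β * p1‖ = 1)
    (f2 : ‖α + β * p2‖ = 1) (f3 : ‖α + β * p3‖ = 1) : α = 0 ∨ β = 0 := by
  have key : ∀ p : ℂ, ‖p‖ = 1 → ‖α + β * p‖ = 1 →
      (starRingEnd ℂ α * β) * p ^ 2 + (α * starRingEnd ℂ α + β * starRingEnd ℂ β - 1) * p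
        + α * starRingEnd ℂ β = 0 := by
    intro p hp hf
    have e1 : p * starRingEnd ℂ p = 1 := by rw [Complex.mul_conj']; simp [hp]
    have e2 : (α + β * p) * starRingEnd ℂ (α + β * p) = 1 := by rw [Complex.mul_conj']; simp [hf]
    rw [map_add, map_mul] at e2
    linear_combination p * e2 - (β * p * starRingEnd ℂ β + α * starRingEnd ℂ β) * e1
  have k1 := key p1 h1 f1
  have k2 := key p2 h2 f2
  have k3 := key p3 h3 f3
  set A := starRingEnd ℂ α * β
  set c := α * starRingEnd ℂ α + β * starRingEnd ℂ β - 1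
  have m12 : A * (p1 + p2) + c = 0 := by
    apply mul_left_cancel₀ (sub_ne_zero.mpr h12); linear_combination k1 - k2
  have m13 : A * (p1 + p3) + c = 0 := by
    apply mul_left_cancel₀ (sub_ne_zero.mpr h13); linear_combination k1 - k3
  have hA : A = 0 := by
    apply mul_left_cancel₀ (sub_ne_zero.mpr h23); linear_combination m12 - m13
  rcases mul_eq_zero.mp hA with h | h
  · left; simpa using h
  · right; exact h

/-- The vectors in the common kernel of the forms of the trivial character and of `ψ`. -/
lemma exists_generic_vector (hd : 3 ≤ d) (hq : ∀ i j, i ≠ j → Nat.Coprime (q i) (q j))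
    (ψ : AddChar (∀ j, ZMod (q j : ℕ)) ℂ) {i1 i2 : Fin d} (hi : i1 ≠ i2)
    (h1 : ψ (torusStep q i1) ≠ 1) (h2 : ψ (torusStep q i2) ≠ 1) :
    ∃ a : Fin d → ℂ, ∑ j, a j = 0 ∧ charForm q ψ a = 0 ∧ (∀ j, a j ≠ 0) ∧
      ∀ φ, φ ≠ 1 → φ ≠ ψ → charForm q φ a ≠ 0 := by
  set K : Submodule ℂ (Fin d → ℂ) :=
    LinearMap.ker (charForm q 1) ⊓ LinearMap.ker (charForm q ψ) with hK
  set p : Fin d → ℂ := fun j => ψ (torusStep q j) with hp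
  have hpne : ∀ i j, i ≠ j → p i ≠ 1 → p i ≠ p j := fun i j hij h he =>
    h (addChar_torusStep_eq hq ψ hij he)
  set t : Fin d → Fin d → Fin d → Fin d → ℂ := fun j k l =>
    Pi.single j (p k - p l) + Pi.single k (p l - p j) + Pi.single l (p j - p k) with ht
  have htφ : ∀ (φ : AddChar (∀ j, ZMod (q j : ℕ)) ℂ) j k l, charForm q φ (t j k l)
      = φ (torusStep q j) * (p k - p l) + φ (torusStep q k) * (p l - p j)
        + φ (torusStep q l) * (p j - p k) := fun φ j k l => by
    simp only [ht, map_add, charForm_single]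
  have htK : ∀ j k l, t j k l ∈ K := fun j k l => by
    refine ⟨?_, ?_⟩
    · rw [SetLike.mem_coe, LinearMap.mem_ker, htφ]; simp only [AddChar.one_apply]; ring
    · rw [SetLike.mem_coe, LinearMap.mem_ker, htφ]; simp only [hp]; ring
  obtain ⟨a, haK, ha⟩ := Module.Dual.exists_forall_mem_ne_zero_of_forall_exists K
    (f := fun s : Fin d ⊕ {φ : AddChar (∀ j, ZMod (q j : ℕ)) ℂ // φ ≠ 1 ∧ φ ≠ ψ} =>
      Sum.elim (fun j => (LinearMap.proj j : Module.Dual ℂ (Fin d → ℂ)))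
        (fun φ => charForm q φ.1) s) (by
    rintro (j | ⟨φ, hφ1, hφψ⟩)
    · have hkl : ∃ k l, k ≠ j ∧ l ≠ j ∧ p k ≠ p l := by
        by_cases hj1 : j = i1
        · obtain ⟨l, hl1, hl2⟩ := exists_third hd i1 i2
          exact ⟨i2, l, hj1 ▸ hi.symm, hj1 ▸ hl1, hpne i2 l hl2.symm h2⟩
        · by_cases hj2 : j = i2
          · obtain ⟨l, hl1, hl2⟩ := exists_third hd i1 i2
            exact ⟨i1, l, hj2 ▸ hi, hj2 ▸ hl2, hpne i1 l hl1.symm h1⟩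
          · exact ⟨i1, i2, Ne.symm hj1, Ne.symm hj2, hpne i1 i2 hi h1⟩
      obtain ⟨k, l, hk, hl, hkl⟩ := hkl
      refine ⟨t j k l, htK j k l, ?_⟩
      simpa [ht, hk.symm, hl.symm, sub_eq_zero] using hkl
    · by_contra! hcon
      simp only [Sum.elim_inr] at hcon
      have hrel : ∀ j k l, φ (torusStep q j) * (p k - p l) + φ (torusStep q k) * (p l - p j)
        + φ (torusStep q l) * (p j - p k) = 0 := fun j k l => by
        rw [← htφ]; exact hcon _ (htK j k l)
      have h12 : p i1 ≠ p i2 := hpne i1 i2 hi h1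
      obtain ⟨i3, h31, h32⟩ := exists_third hd i1 i2
      set β := (φ (torusStep q i1) - φ (torusStep q i2)) / (p i1 - p i2) with hβ
      set α := φ (torusStep q i1) - β * p i1 with hα
      have hf : ∀ j, φ (torusStep q j) = α + β * p j := fun j => by
        have h0 := sub_ne_zero.mpr h12
        have := hrel j i1 i2
        rw [hα, hβ]
        field_simp
        linear_combination this
      have hn : ∀ j, ‖p j‖ = 1 := fun j => AddChar.norm_apply ψ _
      have hfn : ∀ j, ‖α + β * p j‖ = 1 := fun j => by rw [← hf]; exact AddChar.norm_apply φ _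
      rcases affine_unit_circle (hn i1) (hn i2) (hn i3) h12 (hpne i1 i3 h31.symm h1)
        (hpne i2 i3 h32.symm h2) (hfn i1) (hfn i2) (hfn i3) with h0 | h0
      · have hβj : ∀ j, β ^ (q j : ℕ) = 1 := fun j => by
          have e1 := addChar_torusStep_pow φ j
          rw [hf j, h0, zero_add, mul_pow, hp] at e1
          simpa only [addChar_torusStep_pow, mul_one] using e1
        have hβ1 := eq_one_of_coprime_pow (hq i1 i2 hi) (hβj i1) (hβj i2)
        exact hφψ (addChar_torus_ext fun j => by rw [hf j, h0, hβ1, zero_add, one_mul])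
      · have hαj : ∀ j, α ^ (q j : ℕ) = 1 := fun j => by
          have e1 := addChar_torusStep_pow φ j
          rwa [hf j, h0, zero_mul, add_zero] at e1
        have hα1 := eq_one_of_coprime_pow (hq i1 i2 hi) (hαj i1) (hαj i2)
        exact hφ1 (addChar_torus_ext fun j => by
          rw [hf j, h0, hα1, zero_mul, add_zero, AddChar.one_apply]))
  refine ⟨a, ?_, haK.2, fun j => ha (Sum.inl j), fun φ hφ1 hφψ => ha (Sum.inr ⟨φ, hφ1, hφψ⟩)⟩
  have := haK.1
  rw [SetLike.mem_coe, LinearMap.mem_ker, charForm_apply] at this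
  simpa only [AddChar.one_apply, one_mul] using this

end Characters

lemma tendsto_inv_natCast_add_one : Tendsto (fun n : ℕ => ((n : ℂ) + 1)⁻¹) atTop (𝓝 0) := by
  rw [tendsto_zero_iff_norm_tendsto_zero]
  refine tendsto_one_div_add_atTop_nhds_zero_nat.congr fun n => ?_
  rw [norm_inv, one_div]
  congr 1
  have : ((n : ℂ) + 1) = ((n + 1 : ℝ) : ℂ) := by push_cast; ring
  rw [this, Complex.norm_real, Real.norm_of_nonneg (by positivity)]

lemma natCast_add_one_ne_zero (n : ℕ) : ((n : ℂ) + 1) ≠ 0 := by exact_mod_cast n.succ_ne_zero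

lemma tendsto_norm_natCast_add_one : Tendsto (fun n : ℕ => ‖(n : ℂ) + 1‖) atTop atTop := by
  refine tendsto_atTop_mono (fun n => ?_) (tendsto_natCast_atTop_atTop (R := ℝ))
  have : ((n : ℂ) + 1) = ((n + 1 : ℝ) : ℂ) := by push_cast; ring
  rw [this, Complex.norm_real, Real.norm_of_nonneg (by positivity)]
  linarith

/-- Isolating the pole of a sum of reciprocals of linear forms. -/
lemma residue_eq_zero {d : ℕ} {I : Type*} [Fintype I] [DecidableEq I]
    (L : I → Module.Dual ℂ (Fin d → ℂ))
    (i0 ψ : I) (hψ : ψ ≠ i0) (g : I → ℂ) (a b : Fin d → ℂ) (ha : ∀ j, a j ≠ 0)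
    (haψ : L ψ a = 0) (hL : ∀ i, i ≠ i0 → i ≠ ψ → L i a ≠ 0) (hbψ : L ψ b = 1)
    (hsum : ∀ s : ℂ, (∀ j, (a + s • b) j ≠ 0) → (∀ i, i ≠ i0 → L i (a + s • b) ≠ 0) →
      ∑ i ∈ univ.erase i0, g i / L i (a + s • b) = 0) : g ψ = 0 := by
  set s : ℕ → ℂ := fun n => ((n : ℂ) + 1)⁻¹ with hs
  have hs0 : Tendsto s atTop (𝓝 0) := tendsto_inv_natCast_add_one
  have hsne : ∀ n, s n ≠ 0 := fun n => inv_ne_zero (natCast_add_one_ne_zero n)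
  have hLt : ∀ i, Tendsto (fun n => L i (a + s n • b)) atTop (𝓝 (L i a)) := fun i => by
    have : Tendsto (fun n => L i a + s n * L i b) atTop (𝓝 (L i a + 0 * L i b)) :=
      (hs0.mul_const _).const_add _
    rw [zero_mul, add_zero] at this
    exact this.congr fun n => by rw [map_add, map_smul, smul_eq_mul]
  have hat : ∀ j, Tendsto (fun n => (a + s n • b) j) atTop (𝓝 (a j)) := fun j => by
    have : Tendsto (fun n => a j + s n * b j) atTop (𝓝 (a j + 0 * b j)) :=
      (hs0.mul_const _).const_add _
    rw [zero_mul, add_zero] at this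
    exact this
  have hLψ : ∀ n, L ψ (a + s n • b) = s n := fun n => by
    rw [map_add, map_smul, haψ, hbψ, zero_add, smul_eq_mul, mul_one]
  have hev : ∀ᶠ n in atTop, ∑ i ∈ univ.erase i0, g i / L i (a + s n • b) = 0 := by
    have e1 : ∀ᶠ n in atTop, ∀ j, (a + s n • b) j ≠ 0 := by
      rw [eventually_all]
      exact fun j => (hat j).eventually_ne (ha j)
    have e2 : ∀ᶠ n in atTop, ∀ i, i ≠ i0 → L i (a + s n • b) ≠ 0 := by
      rw [eventually_all]
      intro i
      by_cases hi : i = i0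
      · simp [hi]
      · by_cases hi' : i = ψ
        · subst hi'
          exact Eventually.of_forall fun n _ => by rw [hLψ]; exact hsne n
        · filter_upwards [(hLt i).eventually_ne (hL i hi hi')] with n hn _ using hn
    filter_upwards [e1, e2] with n h1 h2 using hsum (s n) h1 h2
  have hψm : ψ ∈ univ.erase i0 := Finset.mem_erase.mpr ⟨hψ, Finset.mem_univ _⟩
  have hlim : Tendsto (fun n => ∑ i ∈ (univ.erase i0).erase ψ,
      s n * (g i / L i (a + s n • b))) atTop (𝓝 (∑ i ∈ (univ.erase i0).erase ψ,
      0 * (g i / L i a))) := by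
    refine tendsto_finsetSum _ fun i hi => hs0.mul (tendsto_const_nhds.div (hLt i) ?_)
    have h1 := Finset.mem_erase.mp hi
    exact hL i (Finset.ne_of_mem_erase h1.2) h1.1
  simp only [zero_mul, Finset.sum_const_zero] at hlim
  have hlim2 : Tendsto (fun _ : ℕ => -g ψ) atTop (𝓝 0) := by
    refine hlim.congr' ?_
    filter_upwards [hev] with n hn
    rw [← Finset.add_sum_erase _ _ hψm, hLψ] at hn
    rw [← Finset.mul_sum, eq_neg_of_add_eq_zero_right hn]
    have := hsne n
    field_simp
  exact neg_eq_zero.mp (tendsto_nhds_unique tendsto_const_nhds hlim2)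

section

variable {d : ℕ} {q : Fin d → ℕ+}

/-- Second-order expansion at a Floquet solution whose multipliers grow linearly along `a`. -/
lemma Bloch.tendsto_second_order {V : (Fin d → ℤ) → ℂ} (hV : IsPeriodic q V) {l : Filter ℕ}
    (hl : l ≤ atTop) {ω : ℕ → Fin d → ℂ} (hω0 : ∀ n j, ω n j ≠ 0) {lam : ℂ}
    (h : ∀ n, Bloch q V (fun j => ω n j ^ (q j : ℕ)) lam) {a : Fin d → ℂ} (ha : ∀ j, a j ≠ 0)
    (hω : ∀ j, Tendsto (fun n => ω n j / ((n : ℂ) + 1)) l (𝓝 (a j)))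
    (hgen : ∀ φ, φ ≠ 1 → charForm q φ a ≠ 0) :
    Tendsto (fun n : ℕ => ((n : ℂ) + 1) *
      (symb (torusStep q) (ω n) 1 - lam + fcoef (toTorus q V) 1)) l
      (𝓝 (-∑ φ ∈ univ.erase 1, fcoef (toTorus q V) (1 / φ) * fcoef (toTorus q V) φ
        / charForm q φ a)) := by
  choose v hv0 hv using fun n => (h n).exists_torusEq hV (hω0 n) (fun _ => rfl)
  have hti := tendsto_inv_natCast_add_one.mono_left hl
  have hinv : ∀ j, Tendsto (fun n => (ω n j)⁻¹) l (𝓝 0) := fun j => by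
    have := ((hω j).inv₀ (ha j)).mul hti
    rw [mul_zero] at this
    refine this.congr fun n => ?_
    have := natCast_add_one_ne_zero n
    have := hω0 n j
    field_simp
  have key := tendsto_resonant (l := l) (1 : AddChar (∀ j, ZMod (q j : ℕ)) ℂ)
    (fun ψ φ => fcoef (toTorus q V) (ψ / φ))
    (fun n ψ => symb (torusStep q) (ω n) ψ - lam) (fun n => fcoef (v n))
    (fun n => (n : ℂ) + 1) (fun φ => -charForm q φ a) (fun n => fcoef_ne_zero (hv0 n))
    (fun n ψ => (hv n).fourier ψ) (tendsto_norm_natCast_add_one.mono_left hl)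
    (fun φ hφ => neg_ne_zero.mpr (hgen φ hφ))
    (fun φ _ => by
      have h1 : Tendsto (fun n : ℕ => -(∑ j, (φ (torusStep q j) * (ω n j / ((n : ℂ) + 1))
          + (φ (torusStep q j))⁻¹ * ((ω n j)⁻¹ * ((n : ℂ) + 1)⁻¹))) - lam * ((n : ℂ) + 1)⁻¹) l
          (𝓝 (-(∑ j, (φ (torusStep q j) * a j + (φ (torusStep q j))⁻¹ * (0 * 0))) - lam * 0)) :=
        (tendsto_finsetSum _ fun j _ => ((hω j).const_mul _).add
          (((hinv j).mul hti).const_mul _)).neg.sub (hti.const_mul _)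
      simp only [mul_zero, add_zero, sub_zero, ← charForm_apply] at h1
      refine h1.congr fun n => ?_
      rw [symb, sub_div, neg_div, Finset.sum_div, div_eq_mul_inv lam]
      congr 2
      refine Finset.sum_congr rfl fun j _ => ?_
      rw [mul_inv, add_div, div_eq_mul_inv, div_eq_mul_inv, div_eq_mul_inv]
      ring)
  simp only [div_self', div_one, div_neg, Finset.sum_neg_distrib] at key
  exact key

/-- Equality of Fermi sets forces equality of the second-order terms. -/
lemma sum_div_charForm_eq_zero (hd : 0 < d) {V : (Fin d → ℤ) → ℂ} (hV : IsPeriodic q V)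
    {Y : Fin d → ℤ → ℂ} (hY : ∀ j n, Y j (n + ((q j : ℕ) : ℤ)) = Y j n) {lam : ℂ}
    (hVY : ∀ z : Fin d → ℂ, (∀ j, z j ≠ 0) →
      Bloch q (fun n => ∑ j, Y j (n j)) z lam → Bloch q V z lam)
    {a : Fin d → ℂ} (ha : ∀ j, a j ≠ 0) (ha0 : ∑ j, a j = 0)
    (hgen : ∀ φ, φ ≠ 1 → charForm q φ a ≠ 0) :
    ∑ φ ∈ univ.erase 1, (fcoef (toTorus q V) (1 / φ) * fcoef (toTorus q V) φ
      - fcoef (toTorus q fun n => ∑ j, Y j (n j)) (1 / φ)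
        * fcoef (toTorus q fun n => ∑ j, Y j (n j)) φ) / charForm q φ a = 0 := by
  set l : Ultrafilter ℕ := hyperfilter ℕ with hldef
  have hl : (l : Filter ℕ) ≤ atTop := Nat.hyperfilter_le_atTop
  have hti := tendsto_inv_natCast_add_one.mono_left hl
  set j0 : Fin d := ⟨0, hd⟩
  set μ : ℕ → Fin d → ℂ := fun n j => -(((n : ℂ) + 1) * a j) + if j = j0 then lam else 0 with hμ
  have hμsum : ∀ n, ∑ j, μ n j = lam := fun n => by
    simp only [hμ, Finset.sum_add_distrib, Finset.sum_neg_distrib, ← Finset.mul_sum, ha0]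
    simp
  have hμt : ∀ j, Tendsto (fun n => μ n j / ((n : ℂ) + 1)) l (𝓝 (-a j)) := fun j => by
    have : Tendsto (fun n : ℕ => -a j + (if j = j0 then lam else 0) * ((n : ℂ) + 1)⁻¹) l
        (𝓝 (-a j + (if j = j0 then lam else 0) * 0)) := (hti.const_mul _).const_add _
    rw [mul_zero, add_zero] at this
    refine this.congr fun n => ?_
    have := natCast_add_one_ne_zero n
    simp only [hμ]
    field_simp
  have hμn : ∀ j, Tendsto (fun n => ‖μ n j‖) l atTop := fun j => by
    have := (hμt j).norm.pos_mul_atTop (norm_pos_iff.mpr (neg_ne_zero.mpr (ha j)))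
      (tendsto_norm_natCast_add_one.mono_left hl)
    refine this.congr fun n => ?_
    rw [← norm_mul, div_mul_cancel₀ _ (natCast_add_one_ne_zero n)]
  choose z hz1 hz using fun n j => exists_blochOne (hY j) (μ n j)
  have hz0 : ∀ n j, z n j ≠ 0 := fun n j => norm_pos_iff.mp (by linarith [hz1 n j])
  choose w hw using fun n => exists_root_coord q (z n)
  have hw0 : ∀ n j, w n j ≠ 0 := fun n j => ne_zero_of_pow_eq (hw n j) (hz0 n j)
  have hroot : ∀ j, ∃ ζ : ℂ, ζ ^ (q j : ℕ) = 1 ∧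
      Tendsto (fun n => μ n j + ζ * w n j) l (𝓝 (mean (q j) (Y j))) := fun j =>
    tendsto_add_root (hY j) (tendsto_norm_root (hY j) (fun n => hz1 n j) (fun n => hw n j) (hμn j)
      (fun n => hz n j)) (fun n => hw0 n j) (fun n => hw n j) (fun n => hz n j)
  choose ζ hζ1 hζ using hroot
  set ω : ℕ → Fin d → ℂ := fun n j => ζ j * w n j with hω
  have hω0 : ∀ n j, ω n j ≠ 0 := fun n j =>
    mul_ne_zero (ne_zero_of_pow_eq (hζ1 j) one_ne_zero) (hw0 n j)
  have hωz : ∀ n, (fun j => ω n j ^ (q j : ℕ)) = z n := fun n => by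
    funext j
    simp only [hω, mul_pow, hζ1, hw, one_mul]
  have hωt : ∀ j, Tendsto (fun n => ω n j / ((n : ℂ) + 1)) l (𝓝 (a j)) := fun j => by
    have := ((hζ j).mul hti).sub (hμt j)
    rw [mul_zero, zero_sub, neg_neg] at this
    refine this.congr fun n => ?_
    simp only [hω]; rw [div_eq_mul_inv, div_eq_mul_inv]; ring
  have hYb : ∀ n, Bloch q (fun n => ∑ j, Y j (n j)) (fun j => ω n j ^ (q j : ℕ)) lam := fun n => by
    rw [hωz, ← hμsum n]; exact bloch_of_blochOne (hz n)
  have hVb : ∀ n, Bloch q V (fun j => ω n j ^ (q j : ℕ)) lam := fun n =>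
    hVY _ (fun j => pow_ne_zero _ (hω0 n j)) (hYb n)
  have tV := Bloch.tendsto_second_order hV hl hω0 hVb ha hωt hgen
  have tY := Bloch.tendsto_second_order (isPeriodic_sum hY) hl hω0 hYb ha hωt hgen
  have tD := tV.sub tY
  set Vt := toTorus q V
  set Yt := toTorus q (fun n => ∑ j, Y j (n j))
  have hD : Tendsto (fun n : ℕ => ((n : ℂ) + 1) * (fcoef Vt 1 - fcoef Yt 1)) l
      (𝓝 (-∑ φ ∈ univ.erase 1, fcoef Vt (1 / φ) * fcoef Vt φ / charForm q φ a
        - -∑ φ ∈ univ.erase 1, fcoef Yt (1 / φ) * fcoef Yt φ / charForm q φ a)) :=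
    tD.congr fun n => by ring
  have hz : fcoef Vt 1 - fcoef Yt 1 = 0 := by
    have := hD.mul hti
    rw [mul_zero] at this
    refine tendsto_nhds_unique tendsto_const_nhds (this.congr fun n => ?_)
    have := natCast_add_one_ne_zero n
    field_simp
  rw [hz] at hD
  simp only [mul_zero] at hD
  have h0 := tendsto_nhds_unique hD tendsto_const_nhds
  simp only [sub_div, Finset.sum_sub_distrib]
  linear_combination -h0

lemma fcoef_real_inv {G : Type*} [AddCommGroup G] [Fintype G] (f : G → ℝ) (ψ : AddChar G ℂ) :
    fcoef (fun x => (f x : ℂ)) ψ⁻¹ = starRingEnd ℂ (fcoef (fun x => (f x : ℂ)) ψ) := by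
  simp only [fcoef, map_mul, map_inv₀, map_natCast, map_sum, Complex.conj_ofReal]
  congr 1
  refine Finset.sum_congr rfl fun x _ => ?_
  rw [AddChar.inv_apply, AddChar.map_neg_eq_conj ψ (-x)]

lemma fcoef_separable_eq_zero (Y : Fin d → ℤ → ℂ) (ψ : AddChar (∀ j, ZMod (q j : ℕ)) ℂ)
    {i1 i2 : Fin d} (hi : i1 ≠ i2) (h1 : ψ (torusStep q i1) ≠ 1) (h2 : ψ (torusStep q i2) ≠ 1) :
    fcoef (toTorus q fun n => ∑ j, Y j (n j)) ψ = 0 := by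
  have he : toTorus q (fun n => ∑ j, Y j (n j)) = fun x => ∑ j, Y j ((x j).val) := rfl
  rw [he, fcoef_sum]
  refine Finset.sum_eq_zero fun j _ => ?_
  obtain ⟨i, hij, hψ⟩ : ∃ i, i ≠ j ∧ ψ (torusStep q i) ≠ 1 := by
    by_cases hj : i1 = j
    · exact ⟨i2, hj ▸ hi.symm, h2⟩
    · exact ⟨i1, hj, h1⟩
  have hs := fcoef_shift (fun x : ∀ j, ZMod (q j : ℕ) => Y j ((x j).val)) (torusStep q i) ψ
  have : (fun x : ∀ j, ZMod (q j : ℕ) => Y j (((x + torusStep q i) j).val))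
      = fun x => Y j ((x j).val) := by
    funext x
    rw [Pi.add_apply, torusStep, Pi.single_eq_of_ne hij.symm, add_zero]
  rw [this] at hs
  by_contra hne
  exact hψ (mul_right_cancel₀ hne (by rw [one_mul]; exact hs.symm))

/-- A real potential whose Fermi set contains that of a separable one has no mixed Fourier
modes. -/
lemma fcoef_eq_zero_of_fermi (hd : 3 ≤ d) (hq : ∀ i j, i ≠ j → Nat.Coprime (q i) (q j))
    {V : (Fin d → ℤ) → ℝ} (hV : IsPeriodic q fun n => (V n : ℂ))
    {Y : Fin d → ℤ → ℂ} (hY : ∀ j n, Y j (n + ((q j : ℕ) : ℤ)) = Y j n) {lam : ℂ}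
    (hVY : ∀ z : Fin d → ℂ, (∀ j, z j ≠ 0) →
      Bloch q (fun n => ∑ j, Y j (n j)) z lam → Bloch q (fun n => (V n : ℂ)) z lam)
    (ψ : AddChar (∀ j, ZMod (q j : ℕ)) ℂ) {i1 i2 : Fin d} (hi : i1 ≠ i2)
    (h1 : ψ (torusStep q i1) ≠ 1) (h2 : ψ (torusStep q i2) ≠ 1) :
    fcoef (toTorus q fun n => (V n : ℂ)) ψ = 0 := by
  classical
  obtain ⟨a, ha0, haψ, ha, hgen⟩ := exists_generic_vector hd hq ψ hi h1 h2
  have hψ1 : ψ ≠ 1 := fun h => h1 (by rw [h, AddChar.one_apply])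
  have hne : ψ (torusStep q i1) - ψ (torusStep q i2) ≠ 0 := fun h =>
    h1 (addChar_torusStep_eq hq ψ hi (sub_eq_zero.mp h))
  set c := (ψ (torusStep q i1) - ψ (torusStep q i2))⁻¹ with hc
  set b : Fin d → ℂ := Pi.single i1 c - Pi.single i2 c with hb
  have hb0 : ∑ j, b j = 0 := by simp [hb]
  have hbψ : charForm q ψ b = 1 := by
    rw [hb, map_sub, charForm_single, charForm_single, ← sub_mul, hc, mul_inv_cancel₀ hne]
  have key := residue_eq_zero (charForm q) 1 ψ hψ1 _ a b ha haψ hgen hbψ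
    (fun s hs hs' => sum_div_charForm_eq_zero (by omega) hV hY hVY hs (by
      simp only [Pi.add_apply, Pi.smul_apply, smul_eq_mul, Finset.sum_add_distrib,
        ← Finset.mul_sum, ha0, hb0, mul_zero, add_zero]) hs')
  rw [fcoef_separable_eq_zero Y ψ hi h1 h2, mul_zero, sub_zero, one_div] at key
  have hr := fcoef_real_inv (fun x : ∀ j, ZMod (q j : ℕ) => V (fun j => ((x j).val : ℤ))) ψ
  change fcoef (toTorus q fun n => (V n : ℂ)) ψ⁻¹
    = starRingEnd ℂ (fcoef (toTorus q fun n => (V n : ℂ)) ψ) at hr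
  rw [hr] at key
  simpa using key

/-- A periodic function without mixed Fourier modes is separable. -/
lemma separable_of_fcoef {V : (Fin d → ℤ) → ℂ} (hV : IsPeriodic q V)
    (h : ∀ (ψ : AddChar (∀ j, ZMod (q j : ℕ)) ℂ) (i1 i2 : Fin d), i1 ≠ i2 →
      ψ (torusStep q i1) ≠ 1 → ψ (torusStep q i2) ≠ 1 → fcoef (toTorus q V) ψ = 0)
    (n : Fin d → ℤ) : V n - V 0 = ∑ j, (V (Pi.single j (n j)) - V 0) := by
  set F := toTorus q V with hF
  have hval : ∀ m : Fin d → ℤ, V m = ∑ ψ : AddChar (∀ j, ZMod (q j : ℕ)) ℂ,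
      fcoef F ψ * ψ (fun j => (m j : ZMod (q j : ℕ))) := fun m => by
    rw [fcoef_inversion, hF, toTorus_intCast hV]
  have hdiff : ∀ m : Fin d → ℤ, V m - V 0 = ∑ ψ : AddChar (∀ j, ZMod (q j : ℕ)) ℂ,
      fcoef F ψ * (ψ (fun j => (m j : ZMod (q j : ℕ))) - 1) := fun m => by
    rw [hval m, hval 0, ← Finset.sum_sub_distrib]
    refine Finset.sum_congr rfl fun ψ _ => ?_
    have : (fun j => (((0 : Fin d → ℤ) j : ℤ) : ZMod (q j : ℕ))) = 0 := by
      funext j; simp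
    rw [this, AddChar.map_zero_eq_one]; ring
  rw [hdiff n, Finset.sum_congr rfl fun j _ => hdiff (Pi.single j (n j)), Finset.sum_comm]
  refine Finset.sum_congr rfl fun ψ _ => ?_
  rw [← Finset.mul_sum]
  by_cases hψ0 : fcoef F ψ = 0
  · rw [hψ0, zero_mul, zero_mul]
  congr 1
  have hprod := addChar_torus_apply ψ (fun j => (n j : ZMod (q j : ℕ)))
  have hsing : ∀ j, ψ (fun i => ((Pi.single j (n j) : Fin d → ℤ) i : ZMod (q i : ℕ)))
      = ψ (torusStep q j) ^ ((n j : ZMod (q j : ℕ))).val := fun j => by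
    rw [addChar_torus_apply, Finset.prod_eq_single j]
    · simp
    · intro i _ hij; simp [hij]
    · simp
  simp only [hsing]
  rw [hprod]
  by_cases hall : ∀ j, ψ (torusStep q j) = 1
  · simp [hall]
  push Not at hall
  obtain ⟨i, hi⟩ := hall
  have hoth : ∀ j, j ≠ i → ψ (torusStep q j) = 1 := fun j hj => by
    by_contra hne
    exact hψ0 (h ψ j i hj hne hi)
  rw [Finset.prod_eq_single i, Finset.sum_eq_single i]
  · intro j _ hj; rw [hoth j hj, one_pow, sub_self]
  · simp
  · intro j _ hj; rw [hoth j hj, one_pow]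
  · simp

end

section

variable {d : ℕ} {q : Fin d → ℕ+}

lemma eq_one_of_re_eq_one {r : ℂ} (hn : ‖r‖ = 1) (hr : r.re = 1) : r = 1 := by
  have h := Complex.sq_norm r
  rw [hn, Complex.normSq_apply, hr] at h
  have him : r.im = 0 := by nlinarith
  exact Complex.ext hr him

/-- One-dimensional Floquet solutions of a summand transfer between separable potentials whose
Fermi sets are nested, up to a shift of the energy. -/
lemma BlochOne.transfer_of_fermi (hd : 3 ≤ d) (hq : ∀ i j, i ≠ j → Nat.Coprime (q i) (q j))
    {V Y : Fin d → ℤ → ℂ} (hV : ∀ j n, V j (n + ((q j : ℕ) : ℤ)) = V j n)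
    (hY : ∀ j n, Y j (n + ((q j : ℕ) : ℤ)) = Y j n) {lam : ℂ}
    (hVY : ∀ z : Fin d → ℂ, (∀ j, z j ≠ 0) →
      Bloch q (fun n => ∑ j, V j (n j)) z lam → Bloch q (fun n => ∑ j, Y j (n j)) z lam)
    (i : Fin d) {x z : ℂ} (hz : z ≠ 0) (h : BlochOne (q i) (V i) z x) :
    BlochOne (q i) (Y i) z
      (x - ∑ j ∈ univ.erase i, (mean (q j) (Y j) - mean (q j) (V j))) := by
  set l : Ultrafilter ℕ := hyperfilter ℕ with hldef
  have hl : (l : Filter ℕ) ≤ atTop := Nat.hyperfilter_le_atTop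
  have hti := tendsto_inv_natCast_add_one.mono_left hl
  obtain ⟨k0, hk0, -⟩ := exists_third hd i i
  obtain ⟨k1, hk1, hk10⟩ := exists_third hd i k0
  set a : Fin d → ℂ := fun j => 1 - (if j = i then 1 else 0)
    - (if j = k0 then ((d : ℂ) - 1) else 0) with ha
  set b : Fin d → ℂ := fun j => (if j = i then x else 0) + (if j = k0 then lam - x else 0) with hb
  have hasum : ∑ j, a j = 0 := by simp [ha, Finset.sum_sub_distrib]
  have hbsum : ∑ j, b j = lam := by simp [hb, Finset.sum_add_distrib]
  have hai : a i = 0 := by simp [ha, hk0.symm]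
  have hbi : b i = x := by simp [hb, hk0.symm]
  have hane : ∀ j, j ≠ i → a j ≠ 0 := by
    intro j hj
    by_cases hjk : j = k0
    · have hd2 : (d : ℂ) ≠ 2 := by
        exact_mod_cast (by omega : d ≠ 2)
      simp only [ha, hjk, hk0, if_false, if_true, sub_zero]
      intro h0
      exact hd2 (by linear_combination -h0)
    · simp [ha, hj, hjk]
  set μ : ℕ → Fin d → ℂ := fun n j => ((n : ℂ) + 1) * a j + b j with hμ
  have hμi : ∀ n, μ n i = x := fun n => by simp only [hμ, hai, hbi, mul_zero, zero_add]
  have hμsum : ∀ n, ∑ j, μ n j = lam := fun n => by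
    simp only [hμ, Finset.sum_add_distrib, ← Finset.mul_sum, hasum, hbsum, mul_zero, zero_add]
  have hμt : ∀ j, Tendsto (fun n => μ n j * ((n : ℂ) + 1)⁻¹) l (𝓝 (a j)) := fun j => by
    have : Tendsto (fun n : ℕ => a j + b j * ((n : ℂ) + 1)⁻¹) l (𝓝 (a j + b j * 0)) :=
      (hti.const_mul _).const_add _
    rw [mul_zero, add_zero] at this
    refine this.congr fun n => ?_
    have := natCast_add_one_ne_zero n
    simp only [hμ]
    field_simp
  have hμn : ∀ j, j ≠ i → Tendsto (fun n => ‖μ n j‖) l atTop := fun j hj => by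
    have := (hμt j).norm.pos_mul_atTop (norm_pos_iff.mpr (hane j hj))
      (tendsto_norm_natCast_add_one.mono_left hl)
    refine this.congr fun n => ?_
    rw [← norm_mul, inv_mul_cancel_right₀ (natCast_add_one_ne_zero n)]
  choose y hy1 hy using fun n j => exists_blochOne (hV j) (μ n j)
  have hyV : ∀ n j, BlochOne (q j) (V j) (Function.update (y n) i z j) (μ n j) := fun n j => by
    by_cases hj : j = i
    · subst hj; rw [Function.update_self, hμi]; exact h
    · rw [Function.update_of_ne hj]; exact hy n j
  have hy0 : ∀ n j, Function.update (y n) i z j ≠ 0 := fun n j => by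
    by_cases hj : j = i
    · subst hj; rw [Function.update_self]; exact hz
    · rw [Function.update_of_ne hj]; exact norm_pos_iff.mp (by linarith [hy1 n j])
  choose ν hνsum hν using fun n => bloch_split hY (hy0 n)
    (hVY _ (hy0 n) (hμsum n ▸ bloch_of_blochOne (hyV n)))
  have hfin : ∃ ν' ∈ {ν' | BlochOne (q i) (Y i) z ν'}, ∀ᶠ n in l, ν n i = ν' := by
    rw [← Ultrafilter.eventually_exists_mem_iff (finite_setOf_blochOne (hY i) hz)]
    refine Eventually.of_forall fun n => ⟨ν n i, ?_, rfl⟩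
    have := hν n i
    rwa [Function.update_self] at this
  obtain ⟨ν', hν', hνev⟩ := hfin
  have hζex : ∀ j, ∃ ζ : ℂ, j ≠ i → ζ ^ (q j : ℕ) = 1 ∧
      Tendsto (fun n => ν n j - ζ * μ n j) l (𝓝 (mean (q j) (Y j) - ζ * mean (q j) (V j))) := by
    intro j
    by_cases hj : j = i
    · exact ⟨0, fun h => absurd hj h⟩
    · obtain ⟨ζ, hζ⟩ := tendsto_energy_sub (hV j) (hY j) (fun n => hy1 n j) (hμn j hj)
        (fun n => hy n j) (fun n => by
          have := hν n j
          rwa [Function.update_of_ne hj] at this)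
      exact ⟨ζ, fun _ => hζ⟩
  choose ζ hζ using hζex
  have hνerase : ∀ᶠ n in l, ∑ j ∈ univ.erase i, ν n j = lam - ν' := by
    filter_upwards [hνev] with n hn
    rw [← hνsum n, ← Finset.add_sum_erase univ _ (Finset.mem_univ i), hn]; ring
  have hS : Tendsto (fun n => lam - ν' - ∑ j ∈ univ.erase i, ζ j * μ n j) l
      (𝓝 (∑ j ∈ univ.erase i, (mean (q j) (Y j) - ζ j * mean (q j) (V j)))) := by
    refine (tendsto_finsetSum _ fun j hj => (hζ j (Finset.ne_of_mem_erase hj)).2).congr' ?_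
    filter_upwards [hνerase] with n hn
    rw [Finset.sum_sub_distrib, hn]
  -- the roots of unity agree, hence are trivial
  have hlead : ∑ j ∈ univ.erase i, ζ j * a j = 0 := by
    have h1 : Tendsto (fun n : ℕ => (lam - ν') * ((n : ℂ) + 1)⁻¹
        - ∑ j ∈ univ.erase i, ζ j * (μ n j * ((n : ℂ) + 1)⁻¹)) l
        (𝓝 ((lam - ν') * 0 - ∑ j ∈ univ.erase i, ζ j * a j)) :=
      (hti.const_mul _).sub (tendsto_finsetSum _ fun j _ => (hμt j).const_mul _)
    have h2 := hS.mul hti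
    rw [mul_zero] at h2
    have h3 := tendsto_nhds_unique h1 (h2.congr fun n => by
      rw [sub_mul, Finset.sum_mul]
      simp only [mul_assoc])
    linear_combination -h3
  have hnorm : ∀ j, j ≠ i → ‖ζ j‖ = 1 := fun j hj =>
    Complex.norm_eq_one_of_pow_eq_one (hζ j hj).1 (q j).pos.ne'
  have hk0n : ζ k0 ≠ 0 := norm_pos_iff.mp (by rw [hnorm k0 hk0]; exact one_pos)
  have hratio : ∑ j ∈ univ.erase i, (1 - ζ j / ζ k0) = 0 := by
    have ha0 : ∑ j ∈ univ.erase i, a j = 0 := by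
      rw [← hasum, ← Finset.add_sum_erase univ _ (Finset.mem_univ i), hai, zero_add]
    have : ∀ j ∈ univ.erase i, 1 - ζ j / ζ k0 = a j - ζ j * a j / ζ k0 := fun j hj => by
      have hji := Finset.ne_of_mem_erase hj
      by_cases hjk : j = k0
      · subst hjk; field_simp; ring
      · simp [ha, hji, hjk]
    rw [Finset.sum_congr rfl this, Finset.sum_sub_distrib, ha0, ← Finset.sum_div, hlead]
    simp
  have hrn : ∀ j, j ≠ i → ‖ζ j / ζ k0‖ = 1 := fun j hj => by
    rw [norm_div, hnorm j hj, hnorm k0 hk0, div_one]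
  have hre : ∀ j, j ≠ i → ζ j = ζ k0 := by
    have h1 := congrArg Complex.re hratio
    rw [Complex.re_sum, Complex.zero_re, Finset.sum_eq_zero_iff_of_nonneg] at h1
    · intro j hj
      have h2 := h1 j (Finset.mem_erase.mpr ⟨hj, Finset.mem_univ _⟩)
      rw [Complex.sub_re, Complex.one_re, sub_eq_zero] at h2
      exact (div_eq_one_iff_eq hk0n).mp (eq_one_of_re_eq_one (hrn j hj) h2.symm)
    · intro j hj
      rw [Complex.sub_re, Complex.one_re, sub_nonneg, ← hrn j (Finset.ne_of_mem_erase hj)]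
      exact Complex.re_le_norm _
  have hζ0 : ζ k0 = 1 := eq_one_of_coprime_pow (hq k0 k1 hk10.symm) (hζ k0 hk0).1
    (hre k1 hk1 ▸ (hζ k1 hk1).1)
  have hμerase : ∀ n, ∑ j ∈ univ.erase i, ζ j * μ n j = lam - x := fun n => by
    rw [← hμsum n, ← Finset.add_sum_erase univ _ (Finset.mem_univ i), hμi, add_sub_cancel_left]
    exact Finset.sum_congr rfl fun j hj => by
      rw [hre j (Finset.ne_of_mem_erase hj), hζ0, one_mul]
  have hC : ∑ j ∈ univ.erase i, (mean (q j) (Y j) - ζ j * mean (q j) (V j))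
      = ∑ j ∈ univ.erase i, (mean (q j) (Y j) - mean (q j) (V j)) :=
    Finset.sum_congr rfl fun j hj => by
      rw [hre j (Finset.ne_of_mem_erase hj), hζ0, one_mul]
  simp only [hμerase, hC] at hS
  have hfinal := tendsto_nhds_unique hS tendsto_const_nhds
  have : x - ∑ j ∈ univ.erase i, (mean (q j) (Y j) - mean (q j) (V j)) = ν' := by
    rw [hfinal]; ring
  rw [this]; exact hν'

lemma bloch_imp_of_fermiVariety_subset {V Y : (Fin d → ℤ) → ℂ} {lam : ℂ}
    (h : FermiVariety q V lam ⊆ FermiVariety q Y lam) (z : Fin d → ℂ) (hz : ∀ j, z j ≠ 0)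
    (hb : Bloch q V z lam) : Bloch q Y z lam := by
  set k : Fin d → ℂ := fun j => Complex.log (z j) / (2 * (Real.pi : ℂ) * Complex.I) with hk
  have hkz : (fun j => Complex.exp (2 * (Real.pi : ℂ) * Complex.I * k j)) = z := by
    funext j
    simp only [hk]
    rw [mul_div_cancel₀ _ Complex.two_pi_I_ne_zero, Complex.exp_log (hz j)]
  have h1 : k ∈ FermiVariety q V lam := by
    change Bloch q V (fun j => Complex.exp (2 * (Real.pi : ℂ) * Complex.I * k j)) lam
    rwa [hkz]
  have h2 : Bloch q Y (fun j => Complex.exp (2 * (Real.pi : ℂ) * Complex.I * k j)) lam := h h1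
  rwa [hkz] at h2

lemma conj_mean (q : ℕ+) (V : ℤ → ℝ) :
    starRingEnd ℂ (mean q fun n => (V n : ℂ)) = mean q fun n => (V n : ℂ) := by
  have := fcoef_real_inv
    (fun x : ∀ _ : Fin 1, ZMod (q : ℕ) => V ((x 0).val : ℤ)) 1
  rw [inv_one] at this
  exact this.symm

lemma BlochOne.add_const_iff (q : ℕ+) (V : ℤ → ℂ) (z lam c : ℂ) :
    BlochOne q (fun n => V n + c) z lam ↔ BlochOne q V z (lam - c) := by
  unfold BlochOne
  refine exists_congr fun u => and_congr_right fun _ => and_congr_left fun _ =>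
    forall_congr' fun n => ?_
  constructor <;> intro h <;> linear_combination h

lemma periodic_summand {V : (Fin d → ℤ) → ℂ} (hV : IsPeriodic q V) {Vj : Fin d → ℤ → ℂ}
    (hs : ∀ n, V n = ∑ j, Vj j (n j)) (j : Fin d) (m : ℤ) :
    Vj j (m + ((q j : ℕ) : ℤ)) = Vj j m := by
  have h := hV (Pi.single j m) j
  rw [hs, hs, ← Finset.add_sum_erase univ _ (Finset.mem_univ j),
    ← Finset.add_sum_erase univ (fun i => Vj i ((Pi.single j m : Fin d → ℤ) i))
      (Finset.mem_univ j), Function.update_self, Pi.single_eq_same] at h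
  refine add_right_cancel (h.trans (congrArg _ (Finset.sum_congr rfl fun i hi => ?_)))
  rw [Function.update_of_ne (Finset.ne_of_mem_erase hi)]

end

end FermiIsospectral

/-- Let `d ≥ 3` and let `V`, `Y` be real `Γ`-periodic potentials
on `ℤ^d` that are Fermi isospectral.  Suppose `Y = Y₁ ⊕ ⋯ ⊕ Y_d` is completely
separable.  Then `V = V₁ ⊕ ⋯ ⊕ V_d` is completely separable and for each `j` there
is a constant `cⱼ ∈ ℝ` such that `Vⱼ + cⱼ` and `Yⱼ` are Floquet isospectral as
`qⱼ`-periodic potentials on `ℤ`. -/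
theorem statement15 (d : ℕ) (hd : 3 ≤ d) (q : Fin d → ℕ+)
    (hq : ∀ i j, i ≠ j → Nat.Coprime (q i) (q j))
    (V Y : (Fin d → ℤ) → ℝ) (hV : IsPeriodicR q V) (hY : IsPeriodicR q Y)
    (lam0 : ℂ)
    (hiso : FermiVariety q (fun n => ((V n : ℝ) : ℂ)) lam0
      = FermiVariety q (fun n => ((Y n : ℝ) : ℂ)) lam0)
    (Yj : Fin d → (ℤ → ℝ)) (hYsep : ∀ n : Fin d → ℤ, Y n = ∑ j, Yj j (n j)) :
    ∃ (Vj : Fin d → (ℤ → ℝ)) (c : Fin d → ℝ),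
      (∀ n : Fin d → ℤ, V n = ∑ j, Vj j (n j)) ∧
      ∀ j : Fin d,
        FloquetIso (fun _ : Fin 1 => q j)
          (fun n : Fin 1 → ℤ => Vj j (n 0) + c j)
          (fun n : Fin 1 → ℤ => Yj j (n 0)) := by
  have hVc : IsPeriodic q fun n => (V n : ℂ) := fun n j => congrArg _ (hV n j)
  have hYc : IsPeriodic q fun n => (Y n : ℂ) := fun n j => congrArg _ (hY n j)
  have hYs : ∀ n : Fin d → ℤ, (Y n : ℂ) = ∑ j, (Yj j (n j) : ℂ) := fun n => by
    rw [hYsep n]; push_cast; rfl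
  have hYeq : (fun n => (Y n : ℂ)) = fun n : Fin d → ℤ => ∑ j, (Yj j (n j) : ℂ) := funext hYs
  have hYp : ∀ j n, ((Yj j (n + ((q j : ℕ) : ℤ)) : ℝ) : ℂ) = (Yj j n : ℂ) :=
    periodic_summand (Vj := fun j n => (Yj j n : ℂ)) hYc hYs
  rw [hYeq] at hiso
  have hYV := bloch_imp_of_fermiVariety_subset hiso.ge
  have hsepc := separable_of_fcoef hVc fun ψ i1 i2 hi h1 h2 =>
    fcoef_eq_zero_of_fermi (Y := fun j n => (Yj j n : ℂ)) hd hq hVc hYp hYV ψ hi h1 h2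
  have hd0 : (d : ℝ) ≠ 0 := by exact_mod_cast (by omega : d ≠ 0)
  set Vj : Fin d → ℤ → ℝ := fun j m => V (Pi.single j m) - V 0 + V 0 / d with hVj
  have hVsep : ∀ n : Fin d → ℤ, V n = ∑ j, Vj j (n j) := fun n => by
    have h1 : V n - V 0 = ∑ j, (V (Pi.single j (n j)) - V 0) := by exact_mod_cast hsepc n
    simp only [hVj]
    rw [Finset.sum_add_distrib, ← h1, Finset.sum_const, Finset.card_univ, Fintype.card_fin,
      nsmul_eq_mul]
    field_simp
    ring
  have hVs : ∀ n : Fin d → ℤ, (V n : ℂ) = ∑ j, (Vj j (n j) : ℂ) := fun n => by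
    rw [hVsep n]; push_cast; rfl
  have hVeq : (fun n => (V n : ℂ)) = fun n : Fin d → ℤ => ∑ j, (Vj j (n j) : ℂ) := funext hVs
  have hVp : ∀ j n, ((Vj j (n + ((q j : ℕ) : ℤ)) : ℝ) : ℂ) = (Vj j n : ℂ) :=
    periodic_summand (Vj := fun j n => (Vj j n : ℂ)) hVc hVs
  rw [hVeq] at hiso
  set C : Fin d → ℂ := fun i => ∑ j ∈ Finset.univ.erase i,
    (mean (q j) (fun n => (Yj j n : ℂ)) - mean (q j) (fun n => (Vj j n : ℂ))) with hC
  have hCre : ∀ i, (((C i).re : ℝ) : ℂ) = C i := fun i => by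
    rw [← Complex.conj_eq_iff_re, hC]
    simp only [map_sum, map_sub, conj_mean]
  refine ⟨Vj, fun i => -(C i).re, hVsep, fun i k => ?_⟩
  set z := Complex.exp (2 * (Real.pi : ℂ) * Complex.I * (k 0 : ℂ)) with hz
  have hz0 : z ≠ 0 := Complex.exp_ne_zero _
  have hkz : (fun j : Fin 1 => Complex.exp (2 * (Real.pi : ℂ) * Complex.I * (k j : ℂ)))
      = fun _ => z := by
    funext j
    rw [Subsingleton.elim j 0]
  rw [hkz]
  have hVcp : ∀ n : ℤ, (fun m : ℤ => ((Vj i m + -(C i).re : ℝ) : ℂ)) (n + ((q i : ℕ) : ℤ))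
      = (fun m : ℤ => ((Vj i m + -(C i).re : ℝ) : ℂ)) n := fun n => by
    simp only [Complex.ofReal_add, hVp]
  have hshift : (fun m : ℤ => ((Vj i m + -(C i).re : ℝ) : ℂ))
      = fun m => (Vj i m : ℂ) + -C i := by
    funext m
    rw [Complex.ofReal_add, Complex.ofReal_neg, hCre]
  ext lam
  have hspecV := (mem_spectrum_DVmat_iff (isPeriodic_fin_one
    (V := fun m : ℤ => ((Vj i m + -(C i).re : ℝ) : ℂ)) hVcp) (fun _ => hz0) lam).trans
    (bloch_fin_one_iff _ (fun m : ℤ => ((Vj i m + -(C i).re : ℝ) : ℂ)) z lam)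
  have hspecY := (mem_spectrum_DVmat_iff
    (isPeriodic_fin_one (V := fun n => (Yj i n : ℂ)) (hYp i)) (fun _ => hz0) lam).trans
    (bloch_fin_one_iff _ (fun n => (Yj i n : ℂ)) z lam)
  refine hspecV.trans (Iff.trans ?_ hspecY.symm)
  rw [hshift, BlochOne.add_const_iff, sub_neg_eq_add]
  constructor
  · intro h
    have := BlochOne.transfer_of_fermi (V := fun j n => (Vj j n : ℂ))
      (Y := fun j n => (Yj j n : ℂ)) hd hq hVp hYp
      (bloch_imp_of_fermiVariety_subset hiso.le) i hz0 h
    change BlochOne (q i) (fun n => (Yj i n : ℂ)) z (lam + C i - C i) at this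
    rwa [add_sub_cancel_right] at this
  · intro h
    have := BlochOne.transfer_of_fermi (V := fun j n => (Yj j n : ℂ))
      (Y := fun j n => (Vj j n : ℂ)) hd hq hYp hVp
      (bloch_imp_of_fermiVariety_subset hiso.ge) i hz0 h
    have hneg : ∑ j ∈ Finset.univ.erase i, (mean (q j) (fun n => (Vj j n : ℂ))
        - mean (q j) (fun n => (Yj j n : ℂ))) = -C i := by
      rw [hC, ← Finset.sum_neg_distrib]
      exact Finset.sum_congr rfl fun j _ => by ring
    rwa [hneg, sub_neg_eq_add] at this

end
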